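/- arXiv:1911.06392 — 10 statements merged into one kernel-verified Lean document; each statement's English description precedes it below -/
import Mathlib

section
/- Let N ≥ 1, p > 3, 0 < β < 2/(p−1), T ∈ (0, 1/2), and C₀ > 0. Suppose u : ℝ^N × [0,T) → ℝ is differentiable in space and satisfies, for all t ∈ [0,T) and x ∈ ℝ^N, |u(x,t) − (T−t)^{−1/(p−1)} f(x/√((T−t)|log(T−t)|))| ≤ C₀ (T−t)^{−1/(p−1)} / ((1 + (|x|²/(T−t))^{β/2}) |log(T−t)|^{(1−β)/2}) and |∇u(x,t) − (T−t)^{−1/2−1/(p−1)} |log(T−t)|^{−1/2} ∇f(x/√((T−t)|log(T−t)|))| ≤ C₀ (T−t)^{−1/2−1/(p−1)} / ((1 + (|x|²/(T−t))^{β/2}) |log(T−t)|^{(1−β)/2}). Then there exists C > 0 such that for all t ∈ [0,T) and all x ∈ ℝ^N with |x| ≥ (T−t)^{1/2} |log(T−t)|^{(1/2)(1 + (2/(p−1) − β)^{−1})}, one has |u(x,t)| ≤ (C/|x|^β) (T−t)^{β/2 − 1/(p−1)} / |log(T−t)|^{(1−β)/2} ≤ C (T−t)^{−1/(p−1)} /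 |log(T−t)|^{1/(2 − β(p−1))}, and |∇u(x,t)| ≤ (C/|x|^β) (T−t)^{β/2 − 1/(p−1) − 1/2} / |log(T−t)|^{(1−β)/2} ≤ C (T−t)^{−1/(p−1) − 1/2} / |log(T−t)|^{1/(2 − β(p−1))}. -/
open MeasureTheory Real Set

/-- The blow-up profile `f(z) = (p-1 + b|z|²)^{-1/(p-1)}` with `b = (p-1)²/(4p)`. -/
noncomputable def profF (N : ℕ) (p : ℝ) (z : EuclideanSpace ℝ (Fin N)) : ℝ :=
  (p - 1 + (p - 1) ^ 2 / (4 * p) * ‖z‖ ^ 2) ^ (-(1 / (p - 1)))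

/-- The profile is dominated by the pure power `b^{-1/(p-1)} |z|^{-2/(p-1)}`. -/
lemma profF_le_rpow {N : ℕ} {p : ℝ} (hp : 1 < p) {z : EuclideanSpace ℝ (Fin N)} (hz : z ≠ 0) :
    profF N p z ≤
      ((p - 1) ^ 2 / (4 * p)) ^ (-(1 / (p - 1))) * ‖z‖ ^ (-(2 * (1 / (p - 1)))) := by
  have hp1 : 0 < p - 1 := by linarith
  have hb : 0 < (p - 1) ^ 2 / (4 * p) := by positivity
  have hz' : 0 < ‖z‖ := norm_pos_iff.2 hz
  have hsq : ‖z‖ ^ (-(2 * (1 / (p - 1)))) = (‖z‖ ^ 2) ^ (-(1 / (p - 1))) := by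
    rw [← Real.rpow_natCast, ← Real.rpow_mul hz'.le]
    congr 1
    push_cast
    ring
  rw [hsq, ← Real.mul_rpow hb.le (by positivity)]
  exact Real.rpow_le_rpow_of_nonpos (by positivity) (by linarith)
    (neg_nonpos.2 (by positivity))

lemma profF_pos {N : ℕ} {p : ℝ} (hp : 1 < p) (z : EuclideanSpace ℝ (Fin N)) :
    0 < profF N p z := by
  have hp1 : 0 < p - 1 := by linarith
  unfold profF
  positivity

lemma norm_gradient_profF_le {N : ℕ} {p : ℝ} (hp : 2 ≤ p) (z : EuclideanSpace ℝ (Fin N)) :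
    ‖gradient (profF N p) z‖ ≤ ((p - 1) ^ 2 / (4 * p) + 1) * profF N p z := by
  have hp1 : 1 ≤ p - 1 := by linarith
  have hf := profF_pos (by linarith : 1 < p) z
  set b := (p - 1) ^ 2 / (4 * p) with hbdef
  have hb : 0 < b := by positivity
  set g := p - 1 + b * ‖z‖ ^ 2 with hgdef
  have hg : 0 < g := by positivity
  have hd : HasFDerivAt (profF N p)
      ((-(1 / (p - 1)) * g ^ (-(1 / (p - 1)) - 1)) • (b • (2 • innerSL ℝ z))) z := by
    have h1 : HasFDerivAt (fun w : EuclideanSpace ℝ (Fin N) => p - 1 + b * ‖w‖ ^ 2)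
        (b • (2 • innerSL ℝ z)) z :=
      ((hasStrictFDerivAt_norm_sq z).hasFDerivAt.const_mul b).const_add (p - 1)
    exact h1.rpow_const (Or.inl hg.ne')
  have hnorm : ‖gradient (profF N p) z‖ = ‖fderiv ℝ (profF N p) z‖ := by
    simp [gradient]
  have hfg : profF N p z = g ^ (-(1 / (p - 1))) := rfl
  have hg1 : g ^ (-(1 / (p - 1)) - 1) = profF N p z / g := by
    rw [Real.rpow_sub_one hg.ne', hfg]
  have ha : 1 / (p - 1) ≤ 1 := by
    rw [div_le_one (by linarith)]
    exact hp1
  have ha0 : 0 ≤ 1 / (p - 1) := by positivity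
  have hlin : b * (2 * ‖z‖) ≤ (b + 1) * g := by
    nlinarith [mul_nonneg hb.le (sq_nonneg (‖z‖ - 1)), mul_pos hb hb,
      mul_nonneg (mul_pos hb hb).le (sq_nonneg ‖z‖)]
  rw [hnorm, hd.fderiv, hg1, norm_smul, norm_smul, ← Nat.cast_smul_eq_nsmul ℝ, norm_smul,
    innerSL_apply_norm, norm_mul, norm_neg, Real.norm_of_nonneg ha0,
    Real.norm_of_nonneg (by positivity : 0 ≤ profF N p z / g), Real.norm_of_nonneg hb.le,
    Real.norm_of_nonneg (by positivity : (0 : ℝ) ≤ (2 : ℕ))]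
  push_cast
  calc 1 / (p - 1) * (profF N p z / g) * (b * (2 * ‖z‖))
      ≤ 1 * (profF N p z / g) * ((b + 1) * g) := by gcongr
    _ = (b + 1) * profF N p z := by field_simp

/-- Far from the origin in the self-similar variable `y`, a decay `y^{-2a} L^a` is absorbed by the
decay `y^{-β} L^{-(1-β)/2}`. -/
lemma rpow_mul_rpow_le_of_far {a β L y : ℝ} (hL : 0 < L) (hδ : 0 < 2 * a - β)
    (h : L ^ ((1 / 2 : ℝ) * (1 + (2 * a - β)⁻¹)) ≤ y) :
    y ^ (-(2 * a)) * L ^ a ≤ y ^ (-β) * L ^ (-((1 - β) / 2)) := by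
  have hy : 0 < y := (Real.rpow_pos_of_pos hL _).trans_le h
  have h1 := Real.rpow_le_rpow_of_nonpos (Real.rpow_pos_of_pos hL _) h (neg_nonpos.2 hδ.le)
  rw [← Real.rpow_mul hL.le] at h1
  calc y ^ (-(2 * a)) * L ^ a = y ^ (-β) * y ^ (-(2 * a - β)) * L ^ a := by
        rw [← Real.rpow_add hy]
        congr 2
        ring
    _ ≤ y ^ (-β) * L ^ ((1 / 2 : ℝ) * (1 + (2 * a - β)⁻¹) * -(2 * a - β)) * L ^ a := by
        gcongr
    _ = y ^ (-β) * L ^ (-((1 - β) / 2)) := by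
        rw [mul_assoc, ← Real.rpow_add hL]
        congr 2
        field_simp
        ring

lemma rpow_mul_rpow_le_rpow_of_far {a β L y : ℝ} (hL : 0 < L) (hβ : 0 ≤ β) (hδ : 0 < 2 * a - β)
    (h : L ^ ((1 / 2 : ℝ) * (1 + (2 * a - β)⁻¹)) ≤ y) :
    y ^ (-β) * L ^ (-((1 - β) / 2)) ≤ L ^ (-(a / (2 * a - β))) := by
  have h1 := Real.rpow_le_rpow_of_nonpos (Real.rpow_pos_of_pos hL _) h (neg_nonpos.2 hβ)
  rw [← Real.rpow_mul hL.le] at h1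
  calc y ^ (-β) * L ^ (-((1 - β) / 2))
      ≤ L ^ ((1 / 2 : ℝ) * (1 + (2 * a - β)⁻¹) * -β) * L ^ (-((1 - β) / 2)) := by gcongr
    _ = L ^ (-(a / (2 * a - β))) := by
        rw [← Real.rpow_add hL]
        congr 1
        field_simp
        ring

lemma div_rpow_selfSimilar {s y L : ℝ} (hs : 0 < s) (hy : 0 < y) (hL : 0 < L) (C e β m : ℝ) :
    C / (s ^ ((1 : ℝ) / 2) * y) ^ β * (s ^ (β / 2 + e) / L ^ m) =
      C * s ^ e * (y ^ (-β) * L ^ (-m)) := by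
  rw [Real.mul_rpow (by positivity) hy.le, ← Real.rpow_mul hs.le, Real.rpow_add hs,
    Real.rpow_neg hy.le, Real.rpow_neg hL.le, show (1 : ℝ) / 2 * β = β / 2 by ring]
  field_simp

/-- The remainder in the blow-up asymptotics, bounded in the self-similar variable `y`. -/
lemma remainder_le_selfSimilar {s y L C A : ℝ} (hs : 0 < s) (hy : 0 < y) (hL : 0 < L)
    (hC : 0 ≤ C) (hA : 0 ≤ A) (β m : ℝ) :
    C * A / ((1 + ((s ^ ((1 : ℝ) / 2) * y) ^ 2 / s) ^ (β / 2)) * L ^ m) ≤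
      C * A * (y ^ (-β) * L ^ (-m)) := by
  have hsq : (s ^ ((1 : ℝ) / 2) * y) ^ 2 / s = y ^ 2 := by
    rw [mul_pow, ← Real.sqrt_eq_rpow, Real.sq_sqrt hs.le]
    field_simp
  have hyβ : (y ^ 2) ^ (β / 2) = y ^ β := by
    rw [← Real.rpow_natCast, ← Real.rpow_mul hy.le]
    congr 1
    push_cast
    ring
  rw [hsq, hyβ, Real.rpow_neg hy.le, Real.rpow_neg hL.le, ← mul_inv, ← div_eq_mul_inv]
  have := Real.rpow_pos_of_pos hy β
  gcongr
  linarith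

theorem stmt_1 (N : ℕ) (hN : 1 ≤ N) (p β T C₀ : ℝ) (hp : 3 < p)
    (hβ0 : 0 < β) (hβ1 : β < 2 / (p - 1)) (hT0 : 0 < T) (hT1 : T < 1 / 2) (hC₀ : 0 < C₀)
    (u : ℝ → EuclideanSpace ℝ (Fin N) → ℝ)
    (hdiff : ∀ t ∈ Ico (0 : ℝ) T, Differentiable ℝ (u t))
    (hu : ∀ t ∈ Ico (0 : ℝ) T, ∀ x,
      |u t x - (T - t) ^ (-(1 / (p - 1))) *
          profF N p ((Real.sqrt ((T - t) * |Real.log (T - t)|))⁻¹ • x)| ≤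
        C₀ * (T - t) ^ (-(1 / (p - 1))) /
          ((1 + (‖x‖ ^ 2 / (T - t)) ^ (β / 2)) * |Real.log (T - t)| ^ ((1 - β) / 2)))
    (hgu : ∀ t ∈ Ico (0 : ℝ) T, ∀ x,
      ‖gradient (u t) x -
          ((T - t) ^ (-(1 / 2 : ℝ) - 1 / (p - 1)) * |Real.log (T - t)| ^ (-(1 / 2) : ℝ)) •
            gradient (profF N p) ((Real.sqrt ((T - t) * |Real.log (T - t)|))⁻¹ • x)‖ ≤
        C₀ * (T - t) ^ (-(1 / 2 : ℝ) - 1 / (p - 1)) /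
          ((1 + (‖x‖ ^ 2 / (T - t)) ^ (β / 2)) * |Real.log (T - t)| ^ ((1 - β) / 2))) :
    ∃ C > 0, ∀ t ∈ Ico (0 : ℝ) T, ∀ x : EuclideanSpace ℝ (Fin N),
      (T - t) ^ ((1 : ℝ) / 2) *
          |Real.log (T - t)| ^ ((1 / 2 : ℝ) * (1 + (2 / (p - 1) - β)⁻¹)) ≤ ‖x‖ →
      (|u t x| ≤ C / ‖x‖ ^ β * ((T - t) ^ (β / 2 - 1 / (p - 1)) /
            |Real.log (T - t)| ^ ((1 - β) / 2)) ∧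
        C / ‖x‖ ^ β * ((T - t) ^ (β / 2 - 1 / (p - 1)) /
            |Real.log (T - t)| ^ ((1 - β) / 2)) ≤
          C * (T - t) ^ (-(1 / (p - 1))) / |Real.log (T - t)| ^ (1 / (2 - β * (p - 1)))) ∧
      (‖gradient (u t) x‖ ≤ C / ‖x‖ ^ β * ((T - t) ^ (β / 2 - 1 / (p - 1) - 1 / 2) /
            |Real.log (T - t)| ^ ((1 - β) / 2)) ∧
        C / ‖x‖ ^ β * ((T - t) ^ (β / 2 - 1 / (p - 1) - 1 / 2) /
            |Real.log (T - t)| ^ ((1 - β) / 2)) ≤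
          C * (T - t) ^ (-(1 / (p - 1)) - 1 / 2) / |Real.log (T - t)| ^ (1 / (2 - β * (p - 1)))) := by
  have hp1 : 0 < p - 1 := by linarith
  have hlog2 : 0 < Real.log 2 := Real.log_pos one_lt_two
  set a := 1 / (p - 1) with ha
  set b := (p - 1) ^ 2 / (4 * p) with hb
  have hb0 : 0 < b := by positivity
  have h2a : 2 / (p - 1) = 2 * a := by rw [ha]; ring
  have hδ : 0 < 2 * a - β := by linarith
  set K := (Real.log 2) ^ (-(1 / 2) : ℝ) * (b + 1) with hK
  have hK0 : 0 < K := by positivity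
  refine ⟨C₀ + (1 + K) * b ^ (-a), by positivity, fun t ht x hx => ?_⟩
  have hut := hu t ht x
  have hgt := hgu t ht x
  have hs : 0 < T - t := by linarith [ht.2]
  have hs2 : T - t < 1 / 2 := by linarith [ht.1]
  generalize T - t = s at *
  have hL : Real.log 2 ≤ |Real.log s| := by
    have := Real.log_le_log hs hs2.le
    rw [one_div, Real.log_inv] at this
    exact (by linarith : Real.log 2 ≤ -Real.log s).trans (neg_le_abs _)
  generalize |Real.log s| = L at *
  have hL0 : 0 < L := hlog2.trans_le hL
  obtain ⟨y, hxy⟩ : ∃ y, ‖x‖ = s ^ ((1 : ℝ) / 2) * y :=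
    ⟨‖x‖ / s ^ ((1 : ℝ) / 2), by field_simp⟩
  rw [h2a, hxy] at hx
  have hfar := le_of_mul_le_mul_left hx (by positivity)
  have hy : 0 < y := (Real.rpow_pos_of_pos hL0 _).trans_le hfar
  have hx0 : x ≠ 0 := norm_pos_iff.1 (by rw [hxy]; positivity)
  set z := (Real.sqrt (s * L))⁻¹ • x with hz
  have hz0 : z ≠ 0 := smul_ne_zero (by positivity) hx0
  have hzn : ‖z‖ ^ (-(2 * a)) = y ^ (-(2 * a)) * L ^ a := by
    have : ‖z‖ = y * L ^ (-(1 / 2) : ℝ) := by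
      rw [hz, norm_smul, hxy, Real.norm_of_nonneg (by positivity), Real.sqrt_mul hs.le,
        Real.sqrt_eq_rpow, Real.sqrt_eq_rpow, Real.rpow_neg hL0.le]
      field_simp
    rw [this, Real.mul_rpow hy.le (by positivity), ← Real.rpow_mul hL0.le]
    congr 2
    ring
  set D := y ^ (-β) * L ^ (-((1 - β) / 2)) with hD
  have hD0 : 0 < D := by positivity
  have hf : profF N p z ≤ b ^ (-a) * D := by
    refine (profF_le_rpow (by linarith) hz0).trans ?_
    rw [hzn]
    exact mul_le_mul_of_nonneg_left (rpow_mul_rpow_le_of_far hL0 hδ hfar) (by positivity)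
  have hf0 := profF_pos (by linarith : 1 < p) z
  have hgrad : L ^ (-(1 / 2) : ℝ) * ‖gradient (profF N p) z‖ ≤ K * (b ^ (-a) * D) := by
    rw [hK, mul_assoc]
    exact mul_le_mul (Real.rpow_le_rpow_of_nonpos hlog2 hL (by norm_num))
      ((norm_gradient_profF_le (by linarith) z).trans (by gcongr))
      (by positivity) (by positivity)
  have hDle : D ≤ L ^ (-(1 / (2 - β * (p - 1)))) := by
    have hexp : a / (2 * a - β) = 1 / (2 - β * (p - 1)) := by
      rw [show 2 - β * (p - 1) = (2 * a - β) * (p - 1) by rw [ha]; field_simp, ha]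
      field_simp
    rw [← hexp]
    exact rpow_mul_rpow_le_rpow_of_far hL0 hβ0.le hδ hfar
  have hsecond : ∀ e : ℝ, (C₀ + (1 + K) * b ^ (-a)) * s ^ e * D ≤
      (C₀ + (1 + K) * b ^ (-a)) * s ^ e / L ^ (1 / (2 - β * (p - 1))) := by
    intro e
    rw [div_eq_mul_inv, ← Real.rpow_neg hL0.le]
    gcongr
  rw [hxy] at hut hgt ⊢
  rw [show β / 2 - a = β / 2 + -a by ring, show β / 2 + -a - 1 / 2 = β / 2 + (-a - 1 / 2) by ring,
    div_rpow_selfSimilar hs hy hL0, div_rpow_selfSimilar hs hy hL0]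
  rw [show -(1 / 2 : ℝ) - a = -a - 1 / 2 by ring] at hgt
  refine ⟨⟨?_, hsecond _⟩, ?_, hsecond _⟩
  · have hr := hut.trans (remainder_le_selfSimilar hs hy hL0 hC₀.le (by positivity) β _)
    have htri := norm_le_norm_add_norm_sub' (u t x) (s ^ (-a) * profF N p z)
    rw [Real.norm_eq_abs, Real.norm_eq_abs, Real.norm_eq_abs,
      abs_of_pos (mul_pos (Real.rpow_pos_of_pos hs _) hf0)] at htri
    calc |u t x| ≤ s ^ (-a) * profF N p z + C₀ * s ^ (-a) * D := by linarith
      _ ≤ s ^ (-a) * (b ^ (-a) * D) + C₀ * s ^ (-a) * D := by gcongr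
      _ ≤ s ^ (-a) * (b ^ (-a) * D) + C₀ * s ^ (-a) * D + K * (s ^ (-a) * (b ^ (-a) * D)) :=
          le_add_of_nonneg_right (by positivity)
      _ = (C₀ + (1 + K) * b ^ (-a)) * s ^ (-a) * D := by ring
  · have hr := hgt.trans (remainder_le_selfSimilar hs hy hL0 hC₀.le (by positivity) β _)
    have htri := norm_le_norm_add_norm_sub' (gradient (u t) x)
      ((s ^ (-a - 1 / 2) * L ^ (-(1 / 2) : ℝ)) • gradient (profF N p) z)
    rw [norm_smul, Real.norm_of_nonneg (by positivity), mul_assoc] at htri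
    calc ‖gradient (u t) x‖
        ≤ s ^ (-a - 1 / 2) * (L ^ (-(1 / 2) : ℝ) * ‖gradient (profF N p) z‖) +
          C₀ * s ^ (-a - 1 / 2) * D := htri.trans (by gcongr)
      _ ≤ s ^ (-a - 1 / 2) * (K * (b ^ (-a) * D)) + C₀ * s ^ (-a - 1 / 2) * D := by gcongr
      _ ≤ s ^ (-a - 1 / 2) * (K * (b ^ (-a) * D)) + C₀ * s ^ (-a - 1 / 2) * D +
          s ^ (-a - 1 / 2) * (b ^ (-a) * D) := le_add_of_nonneg_right (by positivity)
      _ = (C₀ + (1 + K) * b ^ (-a)) * s ^ (-a - 1 / 2) * D := by ring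
end

section
/- For every m ≥ 0 there exists C > 0 such that for all θ > 0, all M > 0 and all measurable r : ℝ → ℝ satisfying |r(x)| ≤ M(1 + |x|^m) for all x ∈ ℝ, one has: (i) |(e^{θ𝓛}r)(y)| ≤ C M e^{θ} (1 + |y|^m) for all y ∈ ℝ; (ii) |(e^{θ𝓛}r)′(y)| ≤ C M e^{θ/2} (1 − e^{−θ})^{−1/2} (1 + |y|^m) for all y ∈ ℝ. -/
open MeasureTheory Real

/-- The semigroup `e^{θ𝓛}` generated by `𝓛 = ∂²_y - (y/2)∂_y + Id` on the real line. -/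
noncomputable def eL (θ : ℝ) (r : ℝ → ℝ) (y : ℝ) : ℝ :=
  (Real.exp θ / Real.sqrt (4 * Real.pi * (1 - Real.exp (-θ)))) *
    ∫ x : ℝ, Real.exp (-(y * Real.exp (-θ / 2) - x) ^ 2 / (4 * (1 - Real.exp (-θ)))) * r x

/-- A Gaussian multiplied by a function of polynomial growth, dominating all the integrands. -/
noncomputable def gaussWeight (b m u : ℝ) : ℝ :=
  Real.exp (-b * u ^ 2) * ((1 + |u|) * (1 + |u| ^ m))

lemma gaussWeight_nonneg (b m u : ℝ) : 0 ≤ gaussWeight b m u := by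
  unfold gaussWeight; positivity

lemma integrable_abs_rpow_mul_exp_neg_mul_sq {b s : ℝ} (hb : 0 < b) (hs : 0 ≤ s) :
    Integrable fun x : ℝ => |x| ^ s * Real.exp (-b * x ^ 2) := by
  obtain ⟨n, hn⟩ := exists_nat_ge s
  have hpow : Integrable fun x : ℝ => x ^ (2 * n) * Real.exp (-b * x ^ 2) := by
    have h := integrable_rpow_mul_exp_neg_mul_sq hb (s := ((2 * n : ℕ) : ℝ))
      (lt_of_lt_of_le (by norm_num) (Nat.cast_nonneg _))
    simpa only [Real.rpow_natCast] using h
  refine ((integrable_exp_neg_mul_sq hb).add hpow).mono' (by fun_prop) (ae_of_all _ fun x => ?_)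
  rw [Real.norm_of_nonneg (by positivity)]
  have key : |x| ^ s ≤ 1 + x ^ (2 * n) := by
    have h0 : 0 ≤ x ^ (2 * n) := (even_two_mul n).pow_nonneg x
    rcases le_total |x| 1 with h | h
    · linarith [Real.rpow_le_one (abs_nonneg x) h hs]
    · have h1 : |x| ^ s ≤ |x| ^ ((2 * n : ℕ) : ℝ) :=
        Real.rpow_le_rpow_of_exponent_le h (by push_cast; linarith)
      rw [Real.rpow_natCast, (even_two_mul n).pow_abs] at h1
      linarith
  calc |x| ^ s * Real.exp (-b * x ^ 2) ≤ (1 + x ^ (2 * n)) * Real.exp (-b * x ^ 2) := by gcongr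
    _ = _ := by simp only [Pi.add_apply]; ring

lemma integrable_gaussWeight {b m : ℝ} (hb : 0 < b) (hm : 0 ≤ m) :
    Integrable (gaussWeight b m) := by
  have h := (((integrable_exp_neg_mul_sq hb).add
    (integrable_abs_rpow_mul_exp_neg_mul_sq hb hm)).add
    (integrable_abs_rpow_mul_exp_neg_mul_sq hb zero_le_one)).add
    (integrable_abs_rpow_mul_exp_neg_mul_sq hb (s := m + 1) (by linarith))
  refine h.congr (ae_of_all _ fun x => ?_)
  simp only [Pi.add_apply, gaussWeight, Real.rpow_one,
    Real.rpow_add_one' (abs_nonneg x) (by linarith : m + 1 ≠ 0)]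
  ring

lemma one_add_rpow_le_mul {m p q x : ℝ} (hm : 0 ≤ m) (hx : 0 ≤ x) (hp : 0 ≤ p) (hq : 0 ≤ q)
    (h : x ≤ p + q) : 1 + x ^ m ≤ 2 ^ m * ((1 + p ^ m) * (1 + q ^ m)) := by
  have h2 : (1 : ℝ) ≤ 2 ^ m := Real.one_le_rpow one_le_two hm
  have hp' : 0 ≤ p ^ m := by positivity
  have hq' : 0 ≤ q ^ m := by positivity
  have hxm : x ^ m ≤ 2 ^ m * (p ^ m + q ^ m) := by
    rcases le_total p q with hpq | hpq
    · calc x ^ m ≤ (2 * q) ^ m := Real.rpow_le_rpow hx (by linarith) hm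
        _ = 2 ^ m * q ^ m := Real.mul_rpow zero_le_two hq
        _ ≤ _ := by gcongr; linarith
    · calc x ^ m ≤ (2 * p) ^ m := Real.rpow_le_rpow hx (by linarith) hm
        _ = 2 ^ m * p ^ m := Real.mul_rpow zero_le_two hp
        _ ≤ _ := by gcongr; linarith
  nlinarith [mul_nonneg (zero_le_one.trans h2) (mul_nonneg hp' hq')]

lemma abs_integral_le_of_le_gaussWeight {m t z B : ℝ} (hm : 0 ≤ m) (ht : 0 < t) {F : ℝ → ℝ}
    (hF : ∀ x, |F x| ≤ B * gaussWeight (1 / 4) m ((x - z) / t)) :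
    |∫ x, F x| ≤ B * (t * ∫ u, gaussWeight (1 / 4) m u) := by
  have hbint : Integrable fun x => B * gaussWeight (1 / 4) m ((x - z) / t) :=
    (((integrable_gaussWeight (by norm_num) hm).comp_div ht.ne').comp_sub_right z).const_mul B
  calc |∫ x, F x| ≤ ∫ x, B * gaussWeight (1 / 4) m ((x - z) / t) :=
        norm_integral_le_of_norm_le (f := F) hbint (ae_of_all _ hF)
    _ = _ := by
        rw [integral_const_mul,
          integral_sub_right_eq_self (fun x => gaussWeight (1 / 4) m (x / t)) z,
          Measure.integral_comp_div, abs_of_pos ht, smul_eq_mul]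

lemma abs_le_gaussWeight {m t z y M x R : ℝ} (hm : 0 ≤ m) (ht : 0 < t) (ht1 : t ≤ 1)
    (hzy : |z| ≤ |y|) (hM : 0 < M) (hR : |R| ≤ M * (1 + |x| ^ m)) :
    Real.exp (-(z - x) ^ 2 / (4 * t ^ 2)) * ((1 + |(x - z) / t|) * |R|) ≤
      (M * 2 ^ m * (1 + |y| ^ m)) * gaussWeight (1 / 4) m ((x - z) / t) := by
  set u := (x - z) / t with hu
  have hxz : x - z = t * u := by rw [hu]; field_simp
  have hexp : -(z - x) ^ 2 / (4 * t ^ 2) = -(1 / 4) * u ^ 2 := by rw [hu]; field_simp; ring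
  have hx : |x| ≤ |y| + |u| := by
    have h1 : |x| ≤ |z| + |x - z| := by simpa using abs_add_le z (x - z)
    have h2 : |x - z| ≤ |u| := by
      rw [hxz, abs_mul, abs_of_pos ht]; exact mul_le_of_le_one_left (abs_nonneg u) ht1
    linarith
  have hb := one_add_rpow_le_mul hm (abs_nonneg x) (abs_nonneg y) (abs_nonneg u) hx
  rw [hexp]
  calc Real.exp (-(1 / 4) * u ^ 2) * ((1 + |u|) * |R|)
      ≤ Real.exp (-(1 / 4) * u ^ 2) * ((1 + |u|) *
        (M * (2 ^ m * ((1 + |y| ^ m) * (1 + |u| ^ m))))) := by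
        gcongr
        exact hR.trans (by gcongr)
    _ = _ := by unfold gaussWeight; ring

/-- Differentiation under the integral sign for Gaussian convolutions. -/
lemma hasDerivAt_integral_gaussian_mul {m s M : ℝ} (hm : 0 ≤ m) (hs : 0 < s) (hM : 0 < M)
    {r : ℝ → ℝ} (hr : Measurable r) (hrM : ∀ x, |r x| ≤ M * (1 + |x| ^ m)) (z₀ : ℝ) :
    HasDerivAt (fun z => ∫ x, Real.exp (-(z - x) ^ 2 / (4 * s)) * r x)
      (∫ x, Real.exp (-(z₀ - x) ^ 2 / (4 * s)) * (-(z₀ - x) / (2 * s)) * r x) z₀ := by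
  have hG (c : ℝ) : Integrable fun x => c * gaussWeight (1 / (8 * s)) m (x - z₀) :=
    ((integrable_gaussWeight (by positivity) hm).comp_sub_right z₀).const_mul c
  have hexp {z : ℝ} (hz : |z - z₀| < 1) (x : ℝ) : Real.exp (-(z - x) ^ 2 / (4 * s)) ≤
      Real.exp (1 / (4 * s)) * Real.exp (-(1 / (8 * s)) * (x - z₀) ^ 2) := by
    rw [← Real.exp_add, Real.exp_le_exp]
    have h1 : (z - z₀) ^ 2 ≤ 1 := by rw [sq_le_one_iff_abs_le_one]; exact hz.le
    have h2 : (x - z₀) ^ 2 ≤ 2 * (z - x) ^ 2 + 2 := by nlinarith [sq_nonneg (2 * z - x - z₀)]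
    rw [← sub_nonneg]
    have : 1 / (4 * s) + -(1 / (8 * s)) * (x - z₀) ^ 2 - -(z - x) ^ 2 / (4 * s) =
        (2 * (z - x) ^ 2 + 2 - (x - z₀) ^ 2) / (8 * s) := by field_simp; ring
    rw [this]
    exact div_nonneg (by linarith) (by positivity)
  have hr' (x : ℝ) : |r x| ≤ M * (2 ^ m * ((1 + |z₀| ^ m) * (1 + |x - z₀| ^ m))) := by
    refine (hrM x).trans ?_
    gcongr
    exact one_add_rpow_le_mul hm (abs_nonneg x) (abs_nonneg z₀) (abs_nonneg _)
      (by simpa using abs_add_le z₀ (x - z₀))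
  refine (hasDerivAt_integral_of_dominated_loc_of_deriv_le
    (F' := fun z x => Real.exp (-(z - x) ^ 2 / (4 * s)) * (-(z - x) / (2 * s)) * r x)
    (bound := fun x => (Real.exp (1 / (4 * s)) * (1 / (2 * s)) * (M * 2 ^ m * (1 + |z₀| ^ m))) *
      gaussWeight (1 / (8 * s)) m (x - z₀))
    (Metric.ball_mem_nhds z₀ one_pos) (Filter.Eventually.of_forall fun z => ?_) ?_ ?_
    (ae_of_all _ fun x z hz => ?_) (hG _) (ae_of_all _ fun x z _ => ?_)).2
  · exact (by fun_prop : Measurable _).aestronglyMeasurable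
  · refine (hG (Real.exp (1 / (4 * s)) * (M * 2 ^ m * (1 + |z₀| ^ m)))).mono'
      (by fun_prop : Measurable _).aestronglyMeasurable (ae_of_all _ fun x => ?_)
    rw [Real.norm_eq_abs, abs_mul, Real.abs_exp]
    calc _ ≤ (Real.exp (1 / (4 * s)) * Real.exp (-(1 / (8 * s)) * (x - z₀) ^ 2)) *
          (M * (2 ^ m * ((1 + |z₀| ^ m) * ((1 + |x - z₀|) * (1 + |x - z₀| ^ m))))) := by
          refine mul_le_mul (hexp (by simp) x) ((hr' x).trans ?_) (abs_nonneg _) (by positivity)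
          gcongr
          exact le_mul_of_one_le_left (by positivity) (by linarith [abs_nonneg (x - z₀)])
      _ = _ := by unfold gaussWeight; ring
  · exact (by fun_prop : Measurable _).aestronglyMeasurable
  · rw [Metric.mem_ball, Real.dist_eq] at hz
    rw [Real.norm_eq_abs, abs_mul, abs_mul, Real.abs_exp, abs_div, abs_neg,
      abs_of_pos (by positivity : 0 < 2 * s)]
    have hzx : |z - x| ≤ 1 + |x - z₀| := by
      have := abs_sub_le z z₀ x
      rw [abs_sub_comm z₀ x] at this
      linarith
    calc _ ≤ (Real.exp (1 / (4 * s)) * Real.exp (-(1 / (8 * s)) * (x - z₀) ^ 2)) *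
          ((1 + |x - z₀|) / (2 * s)) *
          (M * (2 ^ m * ((1 + |z₀| ^ m) * (1 + |x - z₀| ^ m)))) := by
          gcongr
          · exact hexp hz x
          · exact hr' x
      _ = _ := by unfold gaussWeight; ring
  · have h : HasDerivAt (fun z : ℝ => -(z - x) ^ 2 / (4 * s)) (-(z - x) / (2 * s)) z := by
      refine ((((hasDerivAt_id z).sub_const x).pow 2).neg.div_const (4 * s)).congr_deriv ?_
      simp only [id]
      field_simp
      norm_num
      ring
    exact h.exp.mul_const (r x)

theorem stmt_3 (m : ℝ) (hm : 0 ≤ m) :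
    ∃ C > 0, ∀ θ > 0, ∀ M > 0, ∀ r : ℝ → ℝ, Measurable r →
      (∀ x, |r x| ≤ M * (1 + |x| ^ m)) →
      (∀ y, |eL θ r y| ≤ C * M * Real.exp θ * (1 + |y| ^ m)) ∧
      (∀ y, |deriv (eL θ r) y| ≤
        C * M * Real.exp (θ / 2) * (1 - Real.exp (-θ)) ^ (-(1 / 2) : ℝ) * (1 + |y| ^ m)) := by
  set I := ∫ u, gaussWeight (1 / 4) m u with hI
  have hI0 : 0 ≤ I := integral_nonneg (gaussWeight_nonneg _ _)
  refine ⟨2 ^ m * (I + 1), by positivity, fun θ hθ M hM r hr hrM => ?_⟩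
  have he1 : Real.exp (-θ) < 1 := Real.exp_lt_one_iff.2 (by linarith)
  set s := 1 - Real.exp (-θ) with hs
  have hs0 : 0 < s := by linarith
  have hs1 : s ≤ 1 := by linarith [Real.exp_pos (-θ)]
  set t := √s with ht
  have ht0 : 0 < t := Real.sqrt_pos.2 hs0
  have ht1 : t ≤ 1 := Real.sqrt_le_one.2 hs1
  have hst : s = t ^ 2 := (Real.sq_sqrt hs0.le).symm
  have hnorm : Real.exp θ / √(4 * π * s) ≤ Real.exp θ / t := by
    refine div_le_div_of_nonneg_left (Real.exp_pos θ).le ht0 (Real.sqrt_le_sqrt ?_)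
    nlinarith [Real.pi_gt_three]
  have hnorm0 : 0 ≤ Real.exp θ / √(4 * π * s) := by positivity
  have hz (y : ℝ) : |y * Real.exp (-θ / 2)| ≤ |y| := by
    rw [abs_mul, Real.abs_exp]
    exact mul_le_of_le_one_right (abs_nonneg y) (Real.exp_le_one_iff.2 (by linarith))
  refine ⟨fun y => ?_, fun y => ?_⟩
  · have hbound := abs_integral_le_of_le_gaussWeight (z := y * Real.exp (-θ / 2))
      (B := M * 2 ^ m * (1 + |y| ^ m)) hm ht0
      (F := fun x => Real.exp (-(y * Real.exp (-θ / 2) - x) ^ 2 / (4 * s)) * r x) (fun x => by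
        refine le_trans ?_ (abs_le_gaussWeight hm ht0 ht1 (hz y) hM (hrM x))
        rw [abs_mul, Real.abs_exp, ← hst]
        gcongr
        exact le_mul_of_one_le_left (abs_nonneg _) (by simp))
    rw [eL, ← hs, abs_mul, abs_of_nonneg hnorm0]
    calc _ ≤ Real.exp θ / t * (M * 2 ^ m * (1 + |y| ^ m) * (t * I)) := by gcongr
      _ = 2 ^ m * I * M * Real.exp θ * (1 + |y| ^ m) := by field_simp
      _ ≤ _ := by gcongr; linarith
  · have hd : HasDerivAt (eL θ r) (Real.exp θ / √(4 * π * s) *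
        ((∫ x, Real.exp (-(y * Real.exp (-θ / 2) - x) ^ 2 / (4 * s)) *
          (-(y * Real.exp (-θ / 2) - x) / (2 * s)) * r x) * Real.exp (-θ / 2))) y := by
      have h1 : HasDerivAt (fun y : ℝ => y * Real.exp (-θ / 2)) (Real.exp (-θ / 2)) y := by
        simpa using (hasDerivAt_id y).mul_const (Real.exp (-θ / 2))
      exact ((hasDerivAt_integral_gaussian_mul hm hs0 hM hr hrM
        (y * Real.exp (-θ / 2))).comp y h1).const_mul _
    have hbound := abs_integral_le_of_le_gaussWeight (z := y * Real.exp (-θ / 2))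
      (B := 1 / t * (M * 2 ^ m * (1 + |y| ^ m))) hm ht0
      (F := fun x => Real.exp (-(y * Real.exp (-θ / 2) - x) ^ 2 / (4 * s)) *
          (-(y * Real.exp (-θ / 2) - x) / (2 * s)) * r x) (fun x => by
        rw [mul_assoc (1 / t)]
        refine le_trans ?_ (mul_le_mul_of_nonneg_left
          (abs_le_gaussWeight hm ht0 ht1 (hz y) hM (hrM x)) (by positivity))
        have hq : |-(y * Real.exp (-θ / 2) - x) / (2 * s)| ≤
            1 / t * (1 + |(x - y * Real.exp (-θ / 2)) / t|) := by
          have : -(y * Real.exp (-θ / 2) - x) / (2 * s) =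
              1 / t * ((x - y * Real.exp (-θ / 2)) / t / 2) := by
            rw [hst]; field_simp; ring
          rw [this, abs_mul, abs_of_pos (by positivity : 0 < 1 / t), abs_div, abs_two]
          gcongr
          linarith [abs_nonneg ((x - y * Real.exp (-θ / 2)) / t)]
        rw [abs_mul, abs_mul, Real.abs_exp, ← hst]
        calc _ ≤ Real.exp (-(y * Real.exp (-θ / 2) - x) ^ 2 / (4 * s)) *
              (1 / t * (1 + |(x - y * Real.exp (-θ / 2)) / t|)) * |r x| := by gcongr
          _ = _ := by ring)
    have hts : s ^ (-(1 / 2) : ℝ) = 1 / t := by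
      rw [Real.rpow_neg hs0.le, ← Real.sqrt_eq_rpow, one_div]
    have hexp : Real.exp (θ / 2) = Real.exp θ * Real.exp (-θ / 2) := by
      rw [← Real.exp_add]; congr 1; ring
    rw [hd.deriv, abs_mul, abs_of_nonneg hnorm0, abs_mul, Real.abs_exp, hts, hexp]
    calc _ ≤ Real.exp θ / t * (1 / t * (M * 2 ^ m * (1 + |y| ^ m)) * (t * I) *
          Real.exp (-θ / 2)) := by gcongr
      _ = 2 ^ m * I * M * (Real.exp θ * Real.exp (-θ / 2)) * (1 / t) * (1 + |y| ^ m) := by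
          field_simp
      _ ≤ _ := by gcongr; linarith
end

section
/- For every m with 0 < m < 1 there exists C > 0 such that for all θ > 0 and all r ∈ W^{1,∞}(ℝ) with (1 + |y|^m) r ∈ L^∞(ℝ) and (1 + |y|^m) r′ ∈ L^∞(ℝ), one has ‖(1 + |y|^m) (e^{θ𝓛}r)′(y)‖_{L^∞(ℝ)} ≤ C e^{(m+1)θ/2} ‖(1 + |y|^m) r′(y)‖_{L^∞(ℝ)}. -/
open MeasureTheory Real

open ProbabilityTheory

theorem eL_eq_integral_gaussianReal {θ : ℝ} (hθ : 0 < θ) (r : ℝ → ℝ) (y : ℝ) :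
    eL θ r y = Real.exp θ *
      ∫ z, r (z + y * Real.exp (-θ / 2)) ∂gaussianReal 0 (2 * (1 - Real.exp (-θ))).toNNReal := by
  have hs : 0 < 1 - Real.exp (-θ) := by
    rw [sub_pos, Real.exp_lt_one_iff]; linarith
  have hv : (2 * (1 - Real.exp (-θ))).toNNReal ≠ 0 := by
    rw [Ne, Real.toNNReal_eq_zero]; linarith
  have hmap := gaussianReal_map_add_const (μ := 0) (v := (2 * (1 - Real.exp (-θ))).toNNReal)
    (y * Real.exp (-θ / 2))
  have hint := (measurableEmbedding_addRight (y * Real.exp (-θ / 2))).integral_map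
    (μ := gaussianReal 0 (2 * (1 - Real.exp (-θ))).toNNReal) r
  rw [← hint, hmap, integral_gaussianReal_eq_integral_smul hv, eL, div_eq_mul_inv, mul_assoc,
    ← integral_const_mul]
  congr 2
  ext x
  rw [gaussianPDFReal, Real.coe_toNNReal _ (by linarith), smul_eq_mul, zero_add, ← mul_assoc]
  ring_nf

theorem integral_two_add_sq_gaussianReal (v : NNReal) :
    Integrable (fun z : ℝ => 2 + z ^ 2) (gaussianReal 0 v) ∧
      ∫ z : ℝ, (2 + z ^ 2) ∂gaussianReal 0 v = 2 + (v : ℝ) := by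
  have hi : Integrable (fun z : ℝ => z ^ 2) (gaussianReal 0 v) :=
    (memLp_id_gaussianReal (μ := 0) (v := v) 2).integrable_sq
  refine ⟨(integrable_const _).add hi, ?_⟩
  have hvar := variance_id_gaussianReal (μ := 0) (v := v)
  rw [variance_of_integral_eq_zero aemeasurable_id (by simp [integral_id_gaussianReal])] at hvar
  rw [integral_add (integrable_const _) hi]
  simpa using hvar

theorem one_add_abs_rpow_le {m : ℝ} (hm0 : 0 < m) (hm1 : m < 1) {c : ℝ} (hc : 1 ≤ c) (a z : ℝ) :
    1 + |a * c| ^ m ≤ c ^ m * (2 + z ^ 2) * (1 + |z + a| ^ m) := by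
  have hc0 : 0 ≤ c := by linarith
  have hcm : 1 ≤ c ^ m := Real.one_le_rpow hc hm0.le
  have hz : |z| ^ m ≤ 1 + z ^ 2 := by
    rcases le_total |z| 1 with h | h
    · have := Real.rpow_le_one (abs_nonneg z) h hm0.le
      nlinarith [sq_nonneg z]
    · have h1 := Real.rpow_le_rpow_of_exponent_le h hm1.le
      rw [Real.rpow_one] at h1
      nlinarith [sq_abs z]
  have hsub : |a| ^ m ≤ |z + a| ^ m + |z| ^ m := by
    refine le_trans (Real.rpow_le_rpow (abs_nonneg a) ?_ hm0.le)
      (Real.rpow_add_le_add_rpow (abs_nonneg _) (abs_nonneg _) hm0.le hm1.le)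
    simpa using abs_sub (z + a) z
  rw [abs_mul, abs_of_nonneg hc0, Real.mul_rpow (abs_nonneg a) hc0]
  have hp : 0 ≤ |z + a| ^ m := by positivity
  have key : 1 + |a| ^ m ≤ (2 + z ^ 2) * (1 + |z + a| ^ m) := by
    nlinarith [mul_nonneg (sq_nonneg z) hp]
  calc 1 + |a| ^ m * c ^ m ≤ c ^ m * (1 + |a| ^ m) := by linarith
    _ ≤ c ^ m * ((2 + z ^ 2) * (1 + |z + a| ^ m)) := by gcongr
    _ = _ := by ring

theorem hasDerivAt_integral_comp_add_mul {μ : Measure ℝ} [IsProbabilityMeasure μ] {r : ℝ → ℝ}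
    {M₀ M : ℝ} (hr : Differentiable ℝ r) (h0 : ∀ x, |r x| ≤ M₀) (h1 : ∀ x, |deriv r x| ≤ M)
    (c y : ℝ) :
    HasDerivAt (fun y => ∫ z, r (z + y * c) ∂μ) (∫ z, deriv r (z + y * c) * c ∂μ) y := by
  refine (hasDerivAt_integral_of_dominated_loc_of_deriv_le (μ := μ) (s := Set.univ)
    (F := fun y z => r (z + y * c)) (F' := fun y z => deriv r (z + y * c) * c)
    (bound := fun _ => M * |c|) Filter.univ_mem ?_ ?_ ?_ ?_ (integrable_const _) ?_).2
  · exact Filter.Eventually.of_forall fun y =>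
      (hr.continuous.comp (by fun_prop)).aestronglyMeasurable
  · exact Integrable.of_bound (hr.continuous.comp (by fun_prop)).aestronglyMeasurable M₀
      (Filter.Eventually.of_forall fun z => h0 _)
  · exact (((measurable_deriv r).comp (measurable_id.add_const _)).mul_const
      c).aestronglyMeasurable
  · refine Filter.Eventually.of_forall fun z x _ => ?_
    rw [Real.norm_eq_abs, abs_mul]
    exact mul_le_mul_of_nonneg_right (h1 _) (abs_nonneg c)
  · refine Filter.Eventually.of_forall fun z x _ => ?_
    have hlin : HasDerivAt (fun x : ℝ => z + x * c) c x := by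
      simpa using ((hasDerivAt_id x).mul_const c).const_add z
    exact (hr _).hasDerivAt.comp x hlin

theorem stmt_4 (m : ℝ) (hm0 : 0 < m) (hm1 : m < 1) :
    ∃ C > 0, ∀ θ > 0, ∀ (r : ℝ → ℝ) (M₀ M : ℝ), Differentiable ℝ r →
      (∀ x, (1 + |x| ^ m) * |r x| ≤ M₀) →
      (∀ x, (1 + |x| ^ m) * |deriv r x| ≤ M) →
      ∀ y, (1 + |y| ^ m) * |deriv (eL θ r) y| ≤ C * Real.exp ((m + 1) * θ / 2) * M := by
  refine ⟨4, by norm_num, fun θ hθ r M₀ M hr h0 h1 y => ?_⟩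
  have hw (x t : ℝ) : |t| ≤ (1 + |x| ^ m) * |t| :=
    le_mul_of_one_le_left (abs_nonneg t) (le_add_of_nonneg_right (by positivity))
  have hM : 0 ≤ M := (abs_nonneg _).trans ((hw 0 (deriv r 0)).trans (h1 0))
  set v : NNReal := (2 * (1 - Real.exp (-θ))).toNNReal with hv
  set c := Real.exp (-θ / 2) with hc
  set d := Real.exp (θ / 2) with hd
  have hcd : c * d = 1 := by rw [hc, hd, ← Real.exp_add]; simp [neg_div]
  have hd1 : 1 ≤ d := Real.one_le_exp (by linarith)
  have hc0 : 0 < c := Real.exp_pos _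
  have hv2 : (v : ℝ) ≤ 2 := by
    rw [hv, Real.coe_toNNReal']
    exact max_le (by linarith [Real.exp_pos (-θ)]) (by norm_num)
  obtain ⟨hint, hval⟩ := integral_two_add_sq_gaussianReal v
  have hfun : eL θ r = fun y => Real.exp θ * ∫ z, r (z + y * c) ∂gaussianReal 0 v :=
    funext (eL_eq_integral_gaussianReal hθ r)
  have hder := ((hasDerivAt_integral_comp_add_mul (μ := gaussianReal 0 v) hr
    (fun x => (hw x _).trans (h0 x)) (fun x => (hw x _).trans (h1 x)) c y).const_mul
    (Real.exp θ)).deriv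
  have hpt (z : ℝ) : ‖(1 + |y| ^ m) * (deriv r (z + y * c) * c)‖
      ≤ d ^ m * M * c * (2 + z ^ 2) := by
    have hy := one_add_abs_rpow_le hm0 hm1 hd1 (y * c) z
    rw [mul_assoc y, hcd, mul_one] at hy
    rw [Real.norm_eq_abs, abs_mul, abs_mul, abs_of_pos hc0, abs_of_nonneg (by positivity)]
    calc (1 + |y| ^ m) * (|deriv r (z + y * c)| * c)
        ≤ d ^ m * (2 + z ^ 2) * (1 + |z + y * c| ^ m) * (|deriv r (z + y * c)| * c) := by gcongr
      _ = d ^ m * (2 + z ^ 2) * c * ((1 + |z + y * c| ^ m) * |deriv r (z + y * c)|) := by ring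
      _ ≤ d ^ m * (2 + z ^ 2) * c * M := by gcongr; exact h1 _
      _ = _ := by ring
  have hbound : (1 + |y| ^ m) * |∫ z, deriv r (z + y * c) * c ∂gaussianReal 0 v|
      ≤ d ^ m * M * c * 4 := by
    have h := norm_integral_le_of_norm_le (hint.const_mul (d ^ m * M * c))
      (Filter.Eventually.of_forall hpt)
    rw [integral_const_mul, integral_const_mul, hval, Real.norm_eq_abs, abs_mul,
      abs_of_nonneg (by positivity : 0 ≤ 1 + |y| ^ m)] at h
    refine h.trans ?_
    gcongr
    linarith
  have hexp : Real.exp θ * (d ^ m * c) = Real.exp ((m + 1) * θ / 2) := by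
    rw [hd, hc, ← Real.exp_mul, ← Real.exp_add, ← Real.exp_add]
    ring_nf
  rw [hfun, hder, abs_mul, abs_of_pos (Real.exp_pos θ), ← hexp]
  calc _ = Real.exp θ *
        ((1 + |y| ^ m) * |∫ z, deriv r (z + y * c) * c ∂gaussianReal 0 v|) := by ring
    _ ≤ Real.exp θ * (d ^ m * M * c * 4) := by gcongr
    _ = _ := by ring
end

section
/- For every m with 0 < m < 1 there exists C > 0 such that for all θ > 0 and all measurable r : ℝ → ℝ with (1 + |y|^m) r ∈ L^∞(ℝ), one has ‖(1 + |y|^m) (e^{θ𝓛}r)′(y)‖_{L^∞(ℝ)} ≤ C e^{(m+1)θ/2} (1 − e^{−θ})^{−1/2} ‖(1 + |y|^m) r(y)‖_{L^∞(ℝ)}. -/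
open MeasureTheory Real

/-- First absolute moments of a centred Gaussian weight are finite. -/
lemma integrable_abs_add_one_mul_exp_neg_mul_sq {b : ℝ} (hb : 0 < b) :
    Integrable fun x : ℝ => (|x| + 1) * exp (-b * x ^ 2) := by
  have h1 := (integrable_mul_exp_neg_mul_sq hb).norm
  refine (h1.add (integrable_exp_neg_mul_sq hb)).congr (.of_forall fun x => ?_)
  simp only [Pi.add_apply, norm_mul, Real.norm_eq_abs, abs_exp]
  ring

lemma integrable_abs_mul_two_add_abs_mul_exp :
    Integrable fun z : ℝ => |z| * (2 + |z|) * exp (-z ^ 2 / 4) := by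
  have hb : (0 : ℝ) < 1 / 4 := by norm_num
  have h1 := (integrable_mul_exp_neg_mul_sq hb).norm.const_mul 2
  have h2 := integrable_rpow_mul_exp_neg_mul_sq hb (s := 2) (by norm_num)
  refine (h1.add h2).congr (.of_forall fun x => ?_)
  have hx : -x ^ 2 / 4 = -(1 / 4) * x ^ 2 := by ring
  simp only [Pi.add_apply, norm_mul, Real.norm_eq_abs, abs_exp, rpow_two, hx]
  rw [← sq_abs x]
  ring

/-- Differentiation under the integral sign for Gaussian averages of a bounded function. -/
lemma hasDerivAt_integral_exp_neg_sq_mul {b q M : ℝ} (hb : 0 < b) (hq0 : 0 ≤ q) (hq : q ≤ 1)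
    {r : ℝ → ℝ} (hr : Measurable r) (hM : ∀ x, |r x| ≤ M) (y : ℝ) :
    HasDerivAt (fun y => ∫ x, exp (-(y * q - x) ^ 2 / b) * r x)
      (∫ x, exp (-(y * q - x) ^ 2 / b) * (-(2 * (y * q - x) * q) / b) * r x) y := by
  have hM0 : 0 ≤ M := (abs_nonneg _).trans (hM 0)
  have hc : 0 < 1 / (2 * b) := by positivity
  refine (hasDerivAt_integral_of_dominated_loc_of_deriv_le
    (F := fun y x => exp (-(y * q - x) ^ 2 / b) * r x)
    (F' := fun y x => exp (-(y * q - x) ^ 2 / b) * (-(2 * (y * q - x) * q) / b) * r x)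
    (bound := fun x => 2 / b * exp (1 / b) * M *
      ((|y * q - x| + 1) * exp (-(1 / (2 * b)) * (y * q - x) ^ 2)))
    (Metric.ball_mem_nhds y one_pos) ?_ ?_ ?_ ?_ ?_ ?_).2
  · exact .of_forall fun z => by fun_prop
  · have h := ((integrable_exp_neg_mul_sq (b := 1 / b) (by positivity)).comp_sub_left (y * q))
    refine Integrable.mul_bdd (c := M) ?_ hr.aestronglyMeasurable (.of_forall hM)
    refine h.congr (.of_forall fun x => ?_)
    simp only
    congr 1
    ring
  · fun_prop
  · refine .of_forall fun x z hz => ?_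
    have hz1 : |z * q - y * q| ≤ 1 := by
      rw [← sub_mul, abs_mul, abs_of_nonneg hq0]
      have : |z - y| < 1 := by simpa [Real.dist_eq] using hz
      nlinarith [abs_nonneg (z - y)]
    set u := z * q - x
    set v := y * q - x
    have huv : |u - v| ≤ 1 := by simpa [u, v] using hz1
    have hu : |u| ≤ |v| + 1 := by
      have := abs_sub_abs_le_abs_sub u v
      linarith
    have hsq : v ^ 2 / 2 ≤ u ^ 2 + 1 := by
      have : (u - v) ^ 2 ≤ 1 := by rw [← sq_abs]; nlinarith [abs_nonneg (u - v)]
      nlinarith [sq_nonneg (2 * u - v)]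
    have hexp : exp (-u ^ 2 / b) ≤ exp (1 / b) * exp (-(1 / (2 * b)) * v ^ 2) := by
      rw [← exp_add, exp_le_exp]
      have : 1 / b + -(1 / (2 * b)) * v ^ 2 = (1 - v ^ 2 / 2) / b := by field_simp; ring
      rw [this]
      gcongr
      linarith
    have hfac : |-(2 * u * q) / b| ≤ 2 / b * (|v| + 1) := by
      rw [abs_div, abs_neg, abs_mul, abs_mul, abs_two, abs_of_nonneg hq0, abs_of_pos hb]
      have : |u| * q ≤ |v| + 1 := by nlinarith [abs_nonneg u]
      calc 2 * |u| * q / b = 2 / b * (|u| * q) := by ring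
        _ ≤ _ := by gcongr
    rw [norm_mul, norm_mul, Real.norm_eq_abs, Real.norm_eq_abs, Real.norm_eq_abs, abs_exp]
    calc exp (-u ^ 2 / b) * |-(2 * u * q) / b| * |r x|
        ≤ (exp (1 / b) * exp (-(1 / (2 * b)) * v ^ 2)) * (2 / b * (|v| + 1)) * M := by
          gcongr
          exact hM x
      _ = _ := by ring
  · exact ((integrable_abs_add_one_mul_exp_neg_mul_sq hc).comp_sub_left (y * q)).const_mul _
  · refine .of_forall fun x z _ => ?_
    refine HasDerivAt.mul_const ?_ _
    refine HasDerivAt.exp ?_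
    have h := ((((hasDerivAt_id z).mul_const q).sub_const x).pow 2).neg.div_const b
    refine h.congr_deriv ?_
    simp

/-- The weight `1 + |y| ^ m` at `y = w / q` is controlled by the weight at `x`, up to the
growth in `z = (w - x) / s`. -/
lemma one_add_abs_rpow_le_s5 {m q s : ℝ} (hm0 : 0 < m) (hm1 : m < 1) (hq : 0 < q) (hq1 : q ≤ 1)
    (hs : 0 < s) (hs1 : s ≤ 1) (x y : ℝ) :
    1 + |y| ^ m ≤ q ^ (-m) * (2 + |(y * q - x) / s|) * (1 + |x| ^ m) := by
  set z := (y * q - x) / s with hz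
  have hxz : y * q = x + s * z := by
    rw [hz]
    field_simp
    ring
  have hzm : |z| ^ m ≤ 1 + |z| := by
    rcases le_total |z| 1 with h | h
    · have := rpow_le_one (abs_nonneg z) h hm0.le
      linarith [abs_nonneg z]
    · have := rpow_le_rpow_of_exponent_le h hm1.le
      rw [rpow_one] at this
      linarith
  have hsub : |y * q| ^ m ≤ |x| ^ m + |z| ^ m := by
    have h1 : |y * q| ≤ |x| + |z| := by
      rw [hxz]
      refine (abs_add_le _ _).trans ?_
      rw [abs_mul, abs_of_pos hs]
      nlinarith [abs_nonneg z]
    exact (rpow_le_rpow (abs_nonneg _) h1 hm0.le).trans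
      (rpow_add_le_add_rpow (abs_nonneg _) (abs_nonneg _) hm0.le hm1.le)
  have hy : |y| ^ m = q ^ (-m) * |y * q| ^ m := by
    rw [abs_mul, abs_of_pos hq, mul_rpow (abs_nonneg _) hq.le, rpow_neg hq.le]
    have := (rpow_pos_of_pos hq m).ne'
    field_simp
  have hqm : 1 ≤ q ^ (-m) := one_le_rpow_of_pos_of_le_one_of_nonpos hq hq1 (by linarith)
  have hx0 : 0 ≤ |x| ^ m := rpow_nonneg (abs_nonneg _) _
  rw [hy, mul_assoc]
  calc 1 + q ^ (-m) * |y * q| ^ m ≤ q ^ (-m) * (1 + |y * q| ^ m) := by linarith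
    _ ≤ _ := by
      gcongr
      nlinarith [abs_nonneg z]

theorem stmt_5 (m : ℝ) (hm0 : 0 < m) (hm1 : m < 1) :
    ∃ C > 0, ∀ θ > 0, ∀ (r : ℝ → ℝ) (M : ℝ), Measurable r →
      (∀ x, (1 + |x| ^ m) * |r x| ≤ M) →
      ∀ y, (1 + |y| ^ m) * |deriv (eL θ r) y| ≤
        C * Real.exp ((m + 1) * θ / 2) * (1 - Real.exp (-θ)) ^ (-(1 / 2) : ℝ) * M := by
  set g : ℝ → ℝ := fun z => |z| * (2 + |z|) * exp (-z ^ 2 / 4) with hg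
  have hgi : Integrable g := integrable_abs_mul_two_add_abs_mul_exp
  have hI : 0 ≤ ∫ z, g z := integral_nonneg fun z => by positivity
  refine ⟨(∫ z, g z) + 1, by positivity, fun θ hθ r M hr hM y => ?_⟩
  have ha : 0 < 1 - exp (-θ) := by simpa using hθ
  have ha1 : 1 - exp (-θ) ≤ 1 := by linarith [exp_pos (-θ)]
  have hrM : ∀ x, |r x| ≤ M := fun x => by
    refine le_trans ?_ (hM x)
    nlinarith [abs_nonneg (r x), rpow_nonneg (abs_nonneg x) m]
  have hM0 : 0 ≤ M := (abs_nonneg _).trans (hrM 0)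
  set a := 1 - exp (-θ)
  set s := √a
  have hs : 0 < s := sqrt_pos.2 ha
  have hs1 : s ≤ 1 := sqrt_le_one.2 ha1
  have hsa : a = s ^ 2 := (sq_sqrt ha.le).symm
  set q := exp (-θ / 2) with hq
  have hq0 : 0 < q := exp_pos _
  have hq1 : q ≤ 1 := exp_le_one_iff.2 (by linarith)
  have hd := (hasDerivAt_integral_exp_neg_sq_mul (b := 4 * a) (by positivity) hq0.le hq1 hr hrM
    y).const_mul (exp θ / √(4 * π * a))
  have hderiv : deriv (eL θ r) y = _ := hd.deriv
  have hcov : ∫ x, g ((y * q - x) / s) = s * ∫ z, g z := by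
    rw [integral_sub_left_eq_self (fun x => g (x / s)) volume (y * q), Measure.integral_comp_div,
      abs_of_pos hs, smul_eq_mul]
  have hint : (1 + |y| ^ m) *
      |∫ x, exp (-(y * q - x) ^ 2 / (4 * a)) * (-(2 * (y * q - x) * q) / (4 * a)) * r x| ≤
      q / (2 * s) * q ^ (-m) * M * (s * ∫ z, g z) := by
    have hw : 0 ≤ 1 + |y| ^ m := by positivity
    rw [← hcov, ← abs_of_nonneg hw, ← abs_mul, ← integral_const_mul,
      ← integral_const_mul, ← Real.norm_eq_abs]
    refine norm_integral_le_of_norm_le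
      (((hgi.comp_div hs.ne').comp_sub_left (y * q)).const_mul _) (.of_forall fun x => ?_)
    have hwt := one_add_abs_rpow_le_s5 hm0 hm1 hq0 hq1 hs hs1 x y
    have hexp : -(y * q - x) ^ 2 / (4 * a) = -((y * q - x) / s) ^ 2 / 4 := by
      rw [hsa]; field_simp
    have hlin : |-(2 * (y * q - x) * q) / (4 * a)| = q / (2 * s) * |(y * q - x) / s| := by
      rw [hsa, abs_div, abs_neg, abs_mul, abs_mul, abs_two, abs_of_pos hq0, abs_div,
        abs_of_pos hs, abs_of_pos (by positivity : 0 < 4 * s ^ 2)]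
      field_simp
      ring
    rw [hexp, norm_mul, norm_mul, norm_mul, Real.norm_eq_abs, Real.norm_eq_abs, Real.norm_eq_abs,
      Real.norm_eq_abs, abs_exp, hlin, abs_of_nonneg hw, hg]
    set z := (y * q - x) / s
    have key : (1 + |y| ^ m) * |r x| ≤ q ^ (-m) * (2 + |z|) * M := by
      calc (1 + |y| ^ m) * |r x| ≤ q ^ (-m) * (2 + |z|) * (1 + |x| ^ m) * |r x| := by gcongr
        _ = q ^ (-m) * (2 + |z|) * ((1 + |x| ^ m) * |r x|) := by ring
        _ ≤ _ := by gcongr; exact hM x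
    calc (1 + |y| ^ m) * (exp (-z ^ 2 / 4) * (q / (2 * s) * |z|) * |r x|)
        = exp (-z ^ 2 / 4) * (q / (2 * s) * |z|) * ((1 + |y| ^ m) * |r x|) := by ring
      _ ≤ exp (-z ^ 2 / 4) * (q / (2 * s) * |z|) * (q ^ (-m) * (2 + |z|) * M) := by gcongr
      _ = _ := by ring
  have hpre : exp θ / √(4 * π * a) ≤ exp θ / s := by
    gcongr
    exact sqrt_le_sqrt (by nlinarith [pi_gt_three])
  have hpow : a ^ (-(1 / 2) : ℝ) = 1 / s := by
    rw [rpow_neg ha.le, ← sqrt_eq_rpow, one_div]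
  have hexps : exp θ * q * q ^ (-m) = exp ((m + 1) * θ / 2) := by
    rw [hq, ← exp_mul, ← exp_add, ← exp_add]
    congr 1
    ring
  rw [hderiv, abs_mul, abs_of_nonneg (by positivity : 0 ≤ exp θ / √(4 * π * a)), hpow, ← hexps,
    mul_left_comm]
  calc _ ≤ exp θ / s * (q / (2 * s) * q ^ (-m) * M * (s * ∫ z, g z)) := by gcongr
    _ = (∫ z, g z) / 2 * (exp θ * q * q ^ (-m)) * (1 / s) * M := by field_simp
    _ ≤ _ := by gcongr; linarith
end

section
/- Let N ≥ 1 and 0 ≤ m < N. There exists C > 0 such that for every t > 0 and every measurable f : ℝ^N → ℝ with (1 + |x|^m) f ∈ L^∞(ℝ^N), one has ‖(1 + |x|^m)(S(t)f)(x)‖_{L^∞(ℝ^N)} ≤ C ‖(1 + |x|^m) f(x)‖_{L^∞(ℝ^N)}. -/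
open MeasureTheory Real

/-- The heat semigroup `S(t)` on `ℝ^N` (for `t > 0`). -/
noncomputable def heatS (N : ℕ) (t : ℝ) (f : EuclideanSpace ℝ (Fin N) → ℝ)
    (x : EuclideanSpace ℝ (Fin N)) : ℝ :=
  (4 * Real.pi * t) ^ (-(N : ℝ) / 2) * ∫ y, Real.exp (-‖x - y‖ ^ 2 / (4 * t)) * f y

theorem add_rpow_le_two_rpow_mul {a b m : ℝ} (ha : 0 ≤ a) (hb : 0 ≤ b) (hm : 0 ≤ m) :
    (a + b) ^ m ≤ 2 ^ m * (a ^ m + b ^ m) := by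
  have hmax : (max a b) ^ m ≤ a ^ m + b ^ m := by
    rcases max_choice a b with h | h <;> rw [h]
    · linarith [rpow_nonneg hb m]
    · linarith [rpow_nonneg ha m]
  calc (a + b) ^ m ≤ (2 * max a b) ^ m := by
        apply rpow_le_rpow (by positivity) _ hm
        linarith [le_max_left a b, le_max_right a b]
    _ = 2 ^ m * (max a b) ^ m := mul_rpow (by norm_num) (le_max_of_le_left ha)
    _ ≤ 2 ^ m * (a ^ m + b ^ m) := by gcongr

/-- Half of a Gaussian absorbs any fixed power. -/
theorem exists_exp_neg_sq_mul_rpow_le {m : ℝ} (hm : 0 ≤ m) :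
    ∃ A > 0, ∀ u : ℝ, 0 ≤ u → exp (-u ^ 2) * u ^ m ≤ A * exp (-(1 / 2) * u ^ 2) := by
  obtain ⟨k, hk⟩ := exists_nat_ge m
  refine ⟨1 + 2 ^ k * k.factorial, by positivity, fun u hu => ?_⟩
  have hexp : 1 ≤ exp (u ^ 2 / 2) := one_le_exp (by positivity)
  have hpow : u ^ (2 * k) ≤ 2 ^ k * k.factorial * exp (u ^ 2 / 2) := by
    have h := pow_div_factorial_le_exp (x := u ^ 2 / 2) (by positivity) k
    rw [div_le_iff₀ (by positivity), div_pow, div_le_iff₀ (by positivity), ← pow_mul] at h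
    linarith
  have hrpow : u ^ m ≤ 1 + u ^ (2 * k) := by
    rcases le_total u 1 with h | h
    · linarith [rpow_le_one hu h hm, pow_nonneg hu (2 * k)]
    · have : u ^ m ≤ u ^ ((2 * k : ℕ) : ℝ) := by
        apply rpow_le_rpow_of_exponent_le h
        push_cast
        linarith
      rw [rpow_natCast] at this
      linarith
  have hsplit : exp (-(1 / 2) * u ^ 2) = exp (-u ^ 2) * exp (u ^ 2 / 2) := by
    rw [← exp_add]
    ring_nf
  rw [hsplit]
  nlinarith [exp_pos (-u ^ 2)]

theorem integrable_exp_neg_half_mul_norm_sq {V : Type*} [NormedAddCommGroup V]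
    [InnerProductSpace ℝ V] [FiniteDimensional ℝ V] [MeasurableSpace V] [BorelSpace V] :
    Integrable fun v : V => exp (-(1 / 2) * ‖v‖ ^ 2) := by
  by_contra h
  have h1 := GaussianFourier.integral_rexp_neg_mul_sq_norm (V := V) (b := 1 / 2) (by norm_num)
  rw [integral_undef h] at h1
  have : 0 < (π / (1 / 2)) ^ (Module.finrank ℝ V / 2 : ℝ) := by positivity
  linarith

theorem integrable_indicator_ball_norm_rpow_neg {N : ℕ} (hN : 1 ≤ N) {m : ℝ} (hm : m < N) :
    Integrable ((Metric.ball (0 : EuclideanSpace ℝ (Fin N)) 1).indicator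
      fun z => ‖z‖ ^ (-m)) := by
  have : Nonempty (Fin N) := ⟨⟨0, hN⟩⟩
  rw [integrable_indicator_iff Metric.isOpen_ball.measurableSet,
    integrableOn_fun_norm_addHaar volume (f := fun y : ℝ => y ^ (-m))]
  have h : IntegrableOn (fun y : ℝ => y ^ ((N : ℝ) - 1 - m)) (Set.Ioo 0 1) := by
    rw [intervalIntegral.integrableOn_Ioo_rpow_iff zero_lt_one]
    linarith
  refine h.congr_fun (fun y hy => ?_) measurableSet_Ioo
  have hy0 : 0 < y := hy.1
  simp only [finrank_euclideanSpace_fin, smul_eq_mul]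
  rw [← rpow_natCast, ← rpow_add hy0, Nat.cast_sub hN]
  norm_num
  ring_nf

theorem heatS_eq_integral_smul {N : ℕ} {t : ℝ} (ht : 0 < t)
    (f : EuclideanSpace ℝ (Fin N) → ℝ) (w : EuclideanSpace ℝ (Fin N)) :
    heatS N t f (√(4 * t) • w) =
      π ^ (-(N : ℝ) / 2) * ∫ z, exp (-‖w - z‖ ^ 2) * f (√(4 * t) • z) := by
  have hs : 0 < √(4 * t) := by positivity
  have hs2 : √(4 * t) ^ 2 = 4 * t := sq_sqrt (by positivity)
  have hcomp := Measure.integral_comp_smul volume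
    (fun y => exp (-‖√(4 * t) • w - y‖ ^ 2 / (4 * t)) * f y) (√(4 * t))
  have hint : (fun z => exp (-‖√(4 * t) • w - √(4 * t) • z‖ ^ 2 / (4 * t)) * f (√(4 * t) • z))
      = fun z => exp (-‖w - z‖ ^ 2) * f (√(4 * t) • z) := by
    funext z
    rw [← smul_sub, norm_smul, mul_pow, norm_of_nonneg hs.le, hs2]
    congr 2
    field_simp
  rw [hint, finrank_euclideanSpace_fin, abs_of_pos (by positivity), smul_eq_mul] at hcomp
  rw [heatS, hcomp, ← mul_assoc]
  congr 1
  rw [show 4 * π * t = π * (4 * t) by ring, mul_rpow pi_pos.le (by positivity)]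
  congr 1
  rw [sqrt_eq_rpow, ← rpow_natCast, ← rpow_mul (by positivity), ← rpow_neg (by positivity)]
  congr 1
  ring

/-- Pointwise majorant of the weighted heat integrand, after rescaling to unit time. -/
theorem weight_mul_gaussian_le {m A s p u r F M : ℝ} (hm : 0 ≤ m) (hs : 0 < s) (hp : 0 ≤ p)
    (hu : 0 ≤ u) (hr : 0 < r) (hF : 0 ≤ F) (hpur : p ≤ u + r)
    (hA : exp (-u ^ 2) * u ^ m ≤ A * exp (-(1 / 2) * u ^ 2)) (hA0 : 0 ≤ A)
    (hM : (1 + (s * r) ^ m) * F ≤ M) :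
    (1 + (s * p) ^ m) * (exp (-u ^ 2) * F) ≤ 2 ^ m * M *
      ((1 + A) * exp (-(1 / 2) * u ^ 2) + A * (if r < 1 then r ^ (-m) else 0)) := by
  have hsm : 0 < s ^ m := rpow_pos_of_pos hs m
  have hrm : 0 < r ^ m := rpow_pos_of_pos hr m
  have hum : 0 ≤ u ^ m := rpow_nonneg hu m
  have h2 : (1 : ℝ) ≤ 2 ^ m := one_le_rpow (by norm_num) hm
  rw [mul_rpow hs.le hr.le] at hM
  rw [mul_rpow hs.le hp]
  have hM0 : 0 ≤ M := le_trans (by positivity) hM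
  have hE : exp (-u ^ 2) ≤ exp (-(1 / 2) * u ^ 2) := exp_le_exp.2 (by nlinarith [sq_nonneg u])
  have hE1 : exp (-(1 / 2) * u ^ 2) ≤ 1 := exp_le_one_iff.2 (by nlinarith [sq_nonneg u])
  have hpm : p ^ m ≤ 2 ^ m * (u ^ m + r ^ m) :=
    (rpow_le_rpow hp hpur hm).trans (add_rpow_le_two_rpow_mul hu hr.le hm)
  have hsF : s ^ m * F ≤ M * r ^ (-m) := by
    rw [rpow_neg hr.le, ← div_eq_mul_inv, le_div_iff₀ hrm]
    nlinarith
  have hweight : (1 + s ^ m * p ^ m) * F ≤ 2 ^ m * M * (1 + u ^ m * r ^ (-m)) :=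
    calc (1 + s ^ m * p ^ m) * F
        ≤ (2 ^ m + s ^ m * (2 ^ m * (u ^ m + r ^ m))) * F := by gcongr
      _ = 2 ^ m * ((1 + s ^ m * r ^ m) * F + u ^ m * (s ^ m * F)) := by ring
      _ ≤ 2 ^ m * (M + u ^ m * (M * r ^ (-m))) := by gcongr
      _ = 2 ^ m * M * (1 + u ^ m * r ^ (-m)) := by ring
  have hkernel : exp (-u ^ 2) * u ^ m * r ^ (-m) ≤
      A * exp (-(1 / 2) * u ^ 2) + A * (if r < 1 then r ^ (-m) else 0) := by
    have hrn : 0 ≤ r ^ (-m) := rpow_nonneg hr.le _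
    have hE0 := exp_pos (-(1 / 2) * u ^ 2)
    split_ifs with h
    · have : exp (-u ^ 2) * u ^ m * r ^ (-m) ≤ A * r ^ (-m) :=
        mul_le_mul_of_nonneg_right (hA.trans (by nlinarith)) hrn
      nlinarith
    · have hr1 : r ^ (-m) ≤ 1 := rpow_le_one_of_one_le_of_nonpos (not_lt.1 h) (by linarith)
      have : exp (-u ^ 2) * u ^ m * r ^ (-m) ≤ exp (-u ^ 2) * u ^ m :=
        mul_le_of_le_one_right (by positivity) hr1
      linarith
  calc (1 + s ^ m * p ^ m) * (exp (-u ^ 2) * F)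
      = exp (-u ^ 2) * ((1 + s ^ m * p ^ m) * F) := by ring
    _ ≤ exp (-u ^ 2) * (2 ^ m * M * (1 + u ^ m * r ^ (-m))) := by gcongr
    _ = 2 ^ m * M * (exp (-u ^ 2) + exp (-u ^ 2) * u ^ m * r ^ (-m)) := by ring
    _ ≤ _ := mul_le_mul_of_nonneg_left (by linarith) (by positivity)

theorem stmt_6 (N : ℕ) (hN : 1 ≤ N) (m : ℝ) (hm0 : 0 ≤ m) (hm : m < N) :
    ∃ C > 0, ∀ t > 0, ∀ (f : EuclideanSpace ℝ (Fin N) → ℝ) (M : ℝ),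
      Measurable f → (∀ x, (1 + ‖x‖ ^ m) * |f x| ≤ M) →
      ∀ x, (1 + ‖x‖ ^ m) * |heatS N t f x| ≤ C * M := by
  have : Nonempty (Fin N) := ⟨⟨0, hN⟩⟩
  obtain ⟨A, hA0, hA⟩ := exists_exp_neg_sq_mul_rpow_le hm0
  set gauss : EuclideanSpace ℝ (Fin N) → ℝ := fun v => exp (-(1 / 2) * ‖v‖ ^ 2) with hgauss
  set sing : EuclideanSpace ℝ (Fin N) → ℝ :=
    (Metric.ball (0 : EuclideanSpace ℝ (Fin N)) 1).indicator fun z => ‖z‖ ^ (-m) with hsing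
  have hgint : Integrable gauss := integrable_exp_neg_half_mul_norm_sq
  have hsint : Integrable sing := integrable_indicator_ball_norm_rpow_neg hN hm
  have hg0 : 0 ≤ ∫ v, gauss v := integral_nonneg fun v => (exp_pos _).le
  have hs0 : 0 ≤ ∫ v, sing v :=
    integral_nonneg fun v => Set.indicator_nonneg (fun z _ => rpow_nonneg (norm_nonneg z) _) v
  set K := (1 + A) * (∫ v, gauss v) + A * ∫ v, sing v with hK
  have hK0 : 0 ≤ K := by positivity
  refine ⟨π ^ (-(N : ℝ) / 2) * (2 ^ m * (K + 1)), by positivity, fun t ht f M _ hM x => ?_⟩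
  have hs : 0 < √(4 * t) := by positivity
  have hM0 : 0 ≤ M := le_trans (by positivity) (hM 0)
  obtain ⟨w, rfl⟩ : ∃ w, x = √(4 * t) • w := ⟨(√(4 * t))⁻¹ • x, (smul_inv_smul₀ hs.ne' x).symm⟩
  rw [heatS_eq_integral_smul ht]
  set W := 1 + ‖√(4 * t) • w‖ ^ m with hW
  have hW0 : 0 < W := by positivity
  have hmajor : Integrable fun z => 2 ^ m * M * ((1 + A) * gauss (w - z) + A * sing z) :=
    (((hgint.comp_sub_left w).const_mul _).add (hsint.const_mul _)).const_mul _
  have hbound : |∫ z, W * (exp (-‖w - z‖ ^ 2) * f (√(4 * t) • z))| ≤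
      ∫ z, 2 ^ m * M * ((1 + A) * gauss (w - z) + A * sing z) := by
    rw [← norm_eq_abs]
    refine norm_integral_le_of_norm_le hmajor ?_
    filter_upwards [Measure.ae_ne volume (0 : EuclideanSpace ℝ (Fin N))] with z hz
    have h := weight_mul_gaussian_le hm0 hs (norm_nonneg w) (norm_nonneg (w - z))
      (norm_pos_iff.2 hz) (abs_nonneg (f (√(4 * t) • z)))
      (by simpa using norm_add_le (w - z) z) (hA _ (norm_nonneg _)) hA0.le
      (by simpa only [norm_smul, norm_of_nonneg hs.le] using hM (√(4 * t) • z))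
    rw [norm_eq_abs, abs_mul, abs_mul, abs_of_pos hW0, abs_of_pos (exp_pos _), hW, norm_smul,
      norm_of_nonneg hs.le]
    have hsz : sing z = if ‖z‖ < 1 then ‖z‖ ^ (-m) else 0 := by
      by_cases hz1 : ‖z‖ < 1 <;> simp [hsing, hz1]
    rw [hsz]
    exact h
  have hvalue : ∫ z, 2 ^ m * M * ((1 + A) * gauss (w - z) + A * sing z) = 2 ^ m * M * K := by
    rw [integral_const_mul, integral_add ((hgint.comp_sub_left w).const_mul _)
      (hsint.const_mul _), integral_const_mul, integral_const_mul,
      integral_sub_left_eq_self gauss volume w]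
  rw [hvalue, integral_const_mul, abs_mul, abs_of_pos hW0] at hbound
  have hπ : 0 < π ^ (-(N : ℝ) / 2) := by positivity
  rw [abs_mul, abs_of_pos hπ]
  calc W * (π ^ (-(N : ℝ) / 2) * |∫ z, exp (-‖w - z‖ ^ 2) * f (√(4 * t) • z)|)
      = π ^ (-(N : ℝ) / 2) * (W * |∫ z, exp (-‖w - z‖ ^ 2) * f (√(4 * t) • z)|) := by ring
    _ ≤ π ^ (-(N : ℝ) / 2) * (2 ^ m * M * (K + 1)) := by
        refine mul_le_mul_of_nonneg_left (hbound.trans ?_) hπ.le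
        gcongr
        linarith
    _ = π ^ (-(N : ℝ) / 2) * (2 ^ m * (K + 1)) * M := by ring
end

section
/- Let N ≥ 1, q ≥ 2, μ ∈ ℝ, and β > 0 with β(q−1) > N. There exists C > 0 such that for all r > 0 and all C¹ functions u₁, u₂ : ℝ^N → ℝ satisfying sup_x (1+|x|^β)|u_i(x)| ≤ r and sup_x (1+|x|^β)|∇u_i(x)| ≤ r for i = 1, 2, one has sup_x (1+|x|^β) | |∇u₁(x)| ∫_{B(0,|x|)} |u₁(y)|^{q−1} dy − |∇u₂(x)| ∫_{B(0,|x|)} |u₂(y)|^{q−1} dy | ≤ C r^{q−1} ( sup_x (1+|x|^β)|u₁(x) − u₂(x)| + sup_x (1+|x|^β)|∇u₁(x) − ∇u₂(x)| ). -/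
open MeasureTheory Real

lemma abs_rpow_sub_rpow_le {a b M p : ℝ} (ha : 0 ≤ a) (hb : 0 ≤ b) (haM : a ≤ M) (hbM : b ≤ M)
    (hp : 1 ≤ p) : |a ^ p - b ^ p| ≤ p * M ^ (p - 1) * |a - b| := by
  refine (convex_Icc 0 M).norm_image_sub_le_of_norm_hasDerivWithin_le
    (f := fun t : ℝ => t ^ p) (f' := fun t => p * t ^ (p - 1))
    (fun t _ => (Real.hasDerivAt_rpow_const (Or.inr hp)).hasDerivWithinAt) (fun t ht => ?_)
    ⟨hb, hbM⟩ ⟨ha, haM⟩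
  have h0 : 0 ≤ t := ht.1
  rw [Real.norm_of_nonneg (by positivity)]
  exact mul_le_mul_of_nonneg_left (Real.rpow_le_rpow h0 ht.2 (by linarith)) (by linarith)

lemma one_add_rpow_le_two_rpow_mul {t β : ℝ} (ht : 0 ≤ t) (hβ : 0 < β) :
    (1 + t) ^ β ≤ 2 ^ β * (1 + t ^ β) := by
  have htβ : 0 ≤ t ^ β := Real.rpow_nonneg ht β
  have h2 : (0 : ℝ) ≤ 2 ^ β := by positivity
  rcases le_total t 1 with h | h
  · calc (1 + t) ^ β ≤ 2 ^ β := Real.rpow_le_rpow (by linarith) (by linarith) hβ.le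
      _ ≤ 2 ^ β * (1 + t ^ β) := le_mul_of_one_le_right h2 (by linarith)
  · calc (1 + t) ^ β ≤ (2 * t) ^ β := Real.rpow_le_rpow (by linarith) (by linarith) hβ.le
      _ = 2 ^ β * t ^ β := Real.mul_rpow (by norm_num) ht
      _ ≤ 2 ^ β * (1 + t ^ β) := mul_le_mul_of_nonneg_left (by linarith) h2

lemma integrable_one_add_norm_rpow_rpow_neg {E : Type*} [NormedAddCommGroup E] [NormedSpace ℝ E]
    [FiniteDimensional ℝ E] [MeasurableSpace E] [BorelSpace E] (ν : Measure E) [ν.IsAddHaarMeasure]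
    {β p : ℝ} (hβ : 0 < β) (hp : 0 ≤ p) (h : (Module.finrank ℝ E : ℝ) < β * p) :
    Integrable (fun y : E => (1 + ‖y‖ ^ β) ^ (-p)) ν := by
  refine ((integrable_one_add_norm (μ := ν) h).const_mul ((2 ^ β) ^ p)).mono'
    (Measurable.aestronglyMeasurable (by fun_prop)) (ae_of_all _ fun y => ?_)
  have hy : 0 ≤ ‖y‖ := norm_nonneg y
  have hw : 0 < 1 + ‖y‖ ^ β := by positivity
  have h1 : 0 < 1 + ‖y‖ := by positivity
  rw [Real.norm_of_nonneg (by positivity), Real.rpow_neg hw.le, Real.rpow_neg h1.le,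
    Real.rpow_mul h1.le, ← div_eq_mul_inv, inv_eq_one_div,
    div_le_div_iff₀ (by positivity) (by positivity), one_mul,
    ← Real.mul_rpow (by positivity) hw.le]
  exact Real.rpow_le_rpow (by positivity) (one_add_rpow_le_two_rpow_mul hy hβ) hp

theorem stmt_10 (N : ℕ) (hN : 1 ≤ N) (q μ β : ℝ) (hq : 2 ≤ q) (hβ : 0 < β)
    (hβq : (N : ℝ) < β * (q - 1)) :
    ∃ C > 0, ∀ r > (0 : ℝ),
      ∀ u₁ u₂ : EuclideanSpace ℝ (Fin N) → ℝ, ContDiff ℝ 1 u₁ → ContDiff ℝ 1 u₂ →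
      (∀ x, (1 + ‖x‖ ^ β) * |u₁ x| ≤ r) → (∀ x, (1 + ‖x‖ ^ β) * |u₂ x| ≤ r) →
      (∀ x, (1 + ‖x‖ ^ β) * ‖gradient u₁ x‖ ≤ r) →
      (∀ x, (1 + ‖x‖ ^ β) * ‖gradient u₂ x‖ ≤ r) →
      ∀ D₁ D₂ : ℝ,
      (∀ x, (1 + ‖x‖ ^ β) * |u₁ x - u₂ x| ≤ D₁) →
      (∀ x, (1 + ‖x‖ ^ β) * ‖gradient u₁ x - gradient u₂ x‖ ≤ D₂) →
      ∀ x, (1 + ‖x‖ ^ β) *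
        |‖gradient u₁ x‖ * (∫ y in Metric.ball (0 : EuclideanSpace ℝ (Fin N)) ‖x‖,
              |u₁ y| ^ (q - 1)) -
          ‖gradient u₂ x‖ * ∫ y in Metric.ball (0 : EuclideanSpace ℝ (Fin N)) ‖x‖,
              |u₂ y| ^ (q - 1)| ≤
        C * r ^ (q - 1) * (D₁ + D₂) := by
  set p := q - 1
  have hp : 1 ≤ p := by simp only [p]; linarith
  set g : EuclideanSpace ℝ (Fin N) → ℝ := fun y => (1 + ‖y‖ ^ β) ^ (-p) with hg
  have hgi : Integrable g := integrable_one_add_norm_rpow_rpow_neg volume hβ (by linarith)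
    (by simpa using hβq)
  have hw (y : EuclideanSpace ℝ (Fin N)) : 0 < 1 + ‖y‖ ^ β := by positivity
  have hg0 (y) : 0 ≤ g y := Real.rpow_nonneg (hw y).le _
  set K := ∫ y, g y
  have hK : 0 ≤ K := integral_nonneg hg0
  refine ⟨p * K + 1, by positivity, fun r hr u₁ u₂ hu₁ hu₂ b₁ b₂ _ c₂ D₁ D₂ hD₁ hD₂ x => ?_⟩
  have hD₁0 : 0 ≤ D₁ := le_trans (mul_nonneg (hw x).le (abs_nonneg _)) (hD₁ x)
  have hD₂0 : 0 ≤ D₂ := le_trans (mul_nonneg (hw x).le (norm_nonneg _)) (hD₂ x)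
  have le_div {y : EuclideanSpace ℝ (Fin N)} {a c : ℝ} (h : (1 + ‖y‖ ^ β) * a ≤ c) :
      a ≤ c / (1 + ‖y‖ ^ β) := by rwa [le_div_iff₀' (hw y)]
  have hpow {u : EuclideanSpace ℝ (Fin N) → ℝ} (b : ∀ x, (1 + ‖x‖ ^ β) * |u x| ≤ r) (y) :
      |u y| ^ p ≤ r ^ p * g y := by
    have := Real.rpow_le_rpow (abs_nonneg _) (le_div (b y)) (by linarith : 0 ≤ p)
    rwa [Real.div_rpow hr.le (hw y).le, div_eq_mul_inv, ← Real.rpow_neg (hw y).le] at this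
  have hint {u : EuclideanSpace ℝ (Fin N) → ℝ} (hu : ContDiff ℝ 1 u)
      (b : ∀ x, (1 + ‖x‖ ^ β) * |u x| ≤ r) : Integrable (fun y => |u y| ^ p) := by
    refine (hgi.const_mul (r ^ p)).mono' ?_ (ae_of_all _ fun y => ?_)
    · exact (hu.continuous.abs.rpow_const fun _ => Or.inr (by linarith)).aestronglyMeasurable
    · rw [Real.norm_of_nonneg (by positivity)]
      exact hpow b y
  have hdiff (y) : |(|u₁ y| ^ p - |u₂ y| ^ p)| ≤ p * r ^ (p - 1) * D₁ * g y := by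
    have hwy := hw y
    calc |(|u₁ y| ^ p - |u₂ y| ^ p)|
        ≤ p * (r / (1 + ‖y‖ ^ β)) ^ (p - 1) * |(|u₁ y| - |u₂ y|)| :=
          abs_rpow_sub_rpow_le (abs_nonneg _) (abs_nonneg _) (le_div (b₁ y)) (le_div (b₂ y)) hp
      _ ≤ p * (r / (1 + ‖y‖ ^ β)) ^ (p - 1) * (D₁ / (1 + ‖y‖ ^ β)) := by
          gcongr
          exact (abs_abs_sub_abs_le _ _).trans (le_div (hD₁ y))
      _ = p * r ^ (p - 1) * D₁ * g y := by
          simp only [hg]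
          rw [Real.div_rpow hr.le hwy.le, Real.rpow_sub_one hwy.ne', Real.rpow_neg hwy.le]
          have : (1 + ‖y‖ ^ β) ^ p ≠ 0 := by positivity
          field_simp
  set s := Metric.ball (0 : EuclideanSpace ℝ (Fin N)) ‖x‖
  have hgs : ∫ y in s, g y ≤ K := setIntegral_le_integral hgi (ae_of_all _ hg0)
  set I₁ := ∫ y in s, |u₁ y| ^ p with hI₁
  set I₂ := ∫ y in s, |u₂ y| ^ p with hI₂
  have hI₁0 : 0 ≤ I₁ := integral_nonneg fun y => by positivity
  have hI₁le : I₁ ≤ r ^ p * K :=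
    calc I₁ ≤ ∫ y in s, r ^ p * g y := integral_mono (hint hu₁ b₁).integrableOn
          (hgi.const_mul _).integrableOn (hpow b₁)
      _ = r ^ p * ∫ y in s, g y := integral_const_mul _ _
      _ ≤ r ^ p * K := by gcongr
  have hI : |I₁ - I₂| ≤ p * r ^ (p - 1) * D₁ * K :=
    calc |I₁ - I₂| = ‖∫ y in s, (|u₁ y| ^ p - |u₂ y| ^ p)‖ := by
          rw [integral_sub (hint hu₁ b₁).integrableOn (hint hu₂ b₂).integrableOn, Real.norm_eq_abs]
      _ ≤ ∫ y in s, p * r ^ (p - 1) * D₁ * g y :=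
          norm_integral_le_of_norm_le (hgi.const_mul _).integrableOn (ae_of_all _ hdiff)
      _ = p * r ^ (p - 1) * D₁ * ∫ y in s, g y := integral_const_mul _ _
      _ ≤ p * r ^ (p - 1) * D₁ * K := by gcongr
  have hrp : r * r ^ (p - 1) = r ^ p := by
    rw [Real.rpow_sub_one hr.ne']
    field_simp
  have hwx := hw x
  calc (1 + ‖x‖ ^ β) * |‖gradient u₁ x‖ * I₁ - ‖gradient u₂ x‖ * I₂|
      = (1 + ‖x‖ ^ β) * |(‖gradient u₁ x‖ - ‖gradient u₂ x‖) * I₁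
          + ‖gradient u₂ x‖ * (I₁ - I₂)| := by ring_nf
    _ ≤ (1 + ‖x‖ ^ β) * (‖gradient u₁ x - gradient u₂ x‖ * I₁
          + ‖gradient u₂ x‖ * |I₁ - I₂|) := by
        gcongr
        refine (abs_add_le _ _).trans ?_
        rw [abs_mul, abs_mul, abs_norm, abs_of_nonneg hI₁0]
        gcongr
        exact abs_norm_sub_norm_le _ _
    _ = ((1 + ‖x‖ ^ β) * ‖gradient u₁ x - gradient u₂ x‖) * I₁
          + ((1 + ‖x‖ ^ β) * ‖gradient u₂ x‖) * |I₁ - I₂| := by ring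
    _ ≤ D₂ * (r ^ p * K) + r * (p * r ^ (p - 1) * D₁ * K) := by
        gcongr
        · exact hD₂ x
        · exact c₂ x
    _ = r ^ p * (K * D₂ + p * K * D₁) := by rw [← hrp]; ring
    _ ≤ r ^ p * ((p * K + 1) * (D₁ + D₂)) := by
        gcongr
        nlinarith [mul_nonneg (mul_nonneg (sub_nonneg.2 hp) hK) hD₂0]
    _ = (p * K + 1) * r ^ p * (D₁ + D₂) := by ring
end

section
/- Let N ≥ 1, p > 3, N(p−1)/2 + 1 < q < N(p−1)/2 + (p+1)/2, μ ∈ ℝ, N/(q−1) < β < 2/(p−1), and 0 < ε < min(1, (p−1)/4); set γ = (p−q)/(p−1) + (N−1)/2 (note γ > 0). Then for every A ≥ 1 there exist s₅ ≥ 1 and C > 0 such that the following holds for all s ≥ s₅: if v : ℝ^N → ℝ is a C¹ function satisfying sup_y (1+|y|^β)|v(y)| ≤ A² s^{−(1−β)/2}, sup_y |∇v(y)| ≤ A² s^{−1/2}, and sup_y (1+|y|^β)|∇v(y)| ≤ A² s^{−(1−β)/2}, then the function N(y,s) = μ e^{−γs} |∇v(y) + ∇_y φ(y,s)| ∫_{B(0,|y|)}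 |v(y′) + φ(y′,s)|^{q−1} dy′ satisfies sup_{y∈ℝ^N} |N(y,s)| ≤ C e^{−γ s/2}. -/
open MeasureTheory Real

/-- The profile `φ(y,s) = f(y/√s) + (κN/(2ps)) χ₀(y/g_ε(s))` on `ℝ^N`, where
`f(z) = (p-1+b|z|²)^{-1/(p-1)}`, `b = (p-1)²/(4p)`, `κ = (p-1)^{-1/(p-1)}`,
`g_ε(s) = s^{1/2+ε}`. -/
noncomputable def profPhi (N : ℕ) (p ε : ℝ) (χ₀ : EuclideanSpace ℝ (Fin N) → ℝ)
    (s : ℝ) (y : EuclideanSpace ℝ (Fin N)) : ℝ :=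
  (p - 1 + (p - 1) ^ 2 / (4 * p) * ‖(Real.sqrt s)⁻¹ • y‖ ^ 2) ^ (-(1 / (p - 1))) +
    (p - 1) ^ (-(1 / (p - 1))) * N / (2 * p * s) * χ₀ ((s ^ (1 / 2 + ε))⁻¹ • y)

open Filter Topology

theorem abs_deriv_rpow_neg_le {a b c : ℝ} (ha : 0 < a) (hb : 0 < b) (hc : 0 < c) (t : ℝ) :
    |b * (2 * t) * (-a) * (c + b * t ^ 2) ^ (-a - 1)| ≤ a * (b / c + 1) * c ^ (-a) := by
  have hX : 0 < c + b * t ^ 2 := by positivity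
  have hcX : c ≤ c + b * t ^ 2 := by nlinarith [mul_nonneg hb.le (sq_nonneg t)]
  have h1 : 2 * b * |t| ≤ (b / c + 1) * (c + b * t ^ 2) := by
    have h2 : (b / c + 1) * (c + b * t ^ 2) = b + b * t ^ 2 + (c + b ^ 2 / c * t ^ 2) := by
      field_simp
      ring
    have h3 : 0 ≤ c + b ^ 2 / c * t ^ 2 := by positivity
    have h4 : 2 * |t| ≤ 1 + t ^ 2 := by nlinarith [sq_nonneg (|t| - 1), sq_abs t]
    nlinarith
  have h5 : (c + b * t ^ 2) ^ (-a) ≤ c ^ (-a) :=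
    Real.rpow_le_rpow_of_nonpos hc hcX (by linarith)
  have h6 : (c + b * t ^ 2) ^ (-a - 1) * (c + b * t ^ 2) = (c + b * t ^ 2) ^ (-a) := by
    rw [Real.rpow_sub_one hX.ne']
    field_simp
  have h7 : 0 ≤ (c + b * t ^ 2) ^ (-a - 1) := by positivity
  calc |b * (2 * t) * (-a) * (c + b * t ^ 2) ^ (-a - 1)|
      = a * (2 * b * |t|) * (c + b * t ^ 2) ^ (-a - 1) := by
        rw [abs_mul, abs_mul, abs_mul, abs_mul, abs_neg, abs_of_pos ha, abs_of_pos hb,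
          abs_of_nonneg h7, abs_of_pos (two_pos : (0 : ℝ) < 2)]
        ring
    _ ≤ a * ((b / c + 1) * (c + b * t ^ 2)) * (c + b * t ^ 2) ^ (-a - 1) := by gcongr
    _ = a * (b / c + 1) * (c + b * t ^ 2) ^ (-a) := by rw [← h6]; ring
    _ ≤ a * (b / c + 1) * c ^ (-a) := by gcongr

theorem abs_rpow_neg_sub_le {a b c : ℝ} (ha : 0 < a) (hb : 0 < b) (hc : 0 < c) (t u : ℝ) :
    |(c + b * t ^ 2) ^ (-a) - (c + b * u ^ 2) ^ (-a)| ≤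
      a * (b / c + 1) * c ^ (-a) * |t - u| := by
  have hd (x : ℝ) : HasDerivAt (fun x : ℝ => (c + b * x ^ 2) ^ (-a))
      (b * (2 * x) * (-a) * (c + b * x ^ 2) ^ (-a - 1)) x := by
    have h1 : HasDerivAt (fun x : ℝ => c + b * x ^ 2) (b * (2 * x)) x := by
      simpa using ((hasDerivAt_pow 2 x).const_mul b).const_add c
    have hX : 0 < c + b * x ^ 2 := by positivity
    exact h1.rpow_const (Or.inl hX.ne')
  have := convex_univ.norm_image_sub_le_of_norm_hasDerivWithin_le
    (f := fun x : ℝ => (c + b * x ^ 2) ^ (-a))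
    (fun x _ => (hd x).hasDerivWithinAt)
    (fun x _ => by simpa only [Real.norm_eq_abs] using abs_deriv_rpow_neg_le ha hb hc x)
    (Set.mem_univ u) (Set.mem_univ t)
  simpa only [Real.norm_eq_abs] using this

theorem exists_forall_lipschitzWith_profPhi (N : ℕ) {p ε : ℝ} (hp : 1 < p) (hε : 0 ≤ ε)
    {χ₀ : EuclideanSpace ℝ (Fin N) → ℝ} {K : NNReal} (hχ : LipschitzWith K χ₀) :
    ∃ L : NNReal, ∀ s ≥ (1 : ℝ), LipschitzWith L (profPhi N p ε χ₀ s) := by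
  have hp1 : 0 < p - 1 := by linarith
  have hp0 : 0 < p := by linarith
  set a := 1 / (p - 1) with ha
  have ha0 : 0 < a := by positivity
  set b := (p - 1) ^ 2 / (4 * p) with hb
  have hb0 : 0 < b := by positivity
  set L₁ := a * (b / (p - 1) + 1) * (p - 1) ^ (-a) with hL₁
  have hL₁0 : 0 ≤ L₁ := by positivity
  set d := (p - 1) ^ (-a) * N / (2 * p) with hd
  have hd0 : 0 ≤ d := by positivity
  refine ⟨⟨L₁ + d * K, by positivity⟩, fun s hs => LipschitzWith.of_dist_le_mul fun x y => ?_⟩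
  have hs0 : 0 < s := by linarith
  have hscale {r : ℝ} (hr : 1 ≤ r) : ‖r⁻¹ • x - r⁻¹ • y‖ ≤ ‖x - y‖ := by
    rw [← smul_sub, norm_smul, norm_inv, Real.norm_eq_abs, abs_of_pos (by linarith)]
    exact mul_le_of_le_one_left (norm_nonneg _) (inv_le_one_of_one_le₀ hr)
  have h1 : |(p - 1 + b * ‖(√s)⁻¹ • x‖ ^ 2) ^ (-a) - (p - 1 + b * ‖(√s)⁻¹ • y‖ ^ 2) ^ (-a)| ≤
      L₁ * ‖x - y‖ :=
    (abs_rpow_neg_sub_le ha0 hb0 hp1 _ _).trans <| by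
      rw [← hL₁]
      gcongr
      exact (abs_norm_sub_norm_le _ _).trans (hscale (Real.one_le_sqrt.mpr hs))
  have h2 : |χ₀ ((s ^ (1 / 2 + ε))⁻¹ • x) - χ₀ ((s ^ (1 / 2 + ε))⁻¹ • y)| ≤ K * ‖x - y‖ := by
    have := hχ.dist_le_mul ((s ^ (1 / 2 + ε))⁻¹ • x) ((s ^ (1 / 2 + ε))⁻¹ • y)
    rw [Real.dist_eq, dist_eq_norm] at this
    refine this.trans ?_
    gcongr
    exact hscale (Real.one_le_rpow hs (by linarith))
  have h3 : (p - 1) ^ (-a) * N / (2 * p * s) ≤ d := by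
    refine div_le_div_of_nonneg_left (by positivity) (by positivity) ?_
    exact le_mul_of_one_le_right (by positivity) hs
  have h4 : 0 ≤ (p - 1) ^ (-a) * N / (2 * p * s) := by positivity
  rw [Real.dist_eq, dist_eq_norm]
  calc |profPhi N p ε χ₀ s x - profPhi N p ε χ₀ s y|
      = |((p - 1 + b * ‖(√s)⁻¹ • x‖ ^ 2) ^ (-a) - (p - 1 + b * ‖(√s)⁻¹ • y‖ ^ 2) ^ (-a)) +
          (p - 1) ^ (-a) * N / (2 * p * s) *
          (χ₀ ((s ^ (1 / 2 + ε))⁻¹ • x) - χ₀ ((s ^ (1 / 2 + ε))⁻¹ • y))| := by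
        unfold profPhi
        congr 1
        ring
    _ ≤ L₁ * ‖x - y‖ + d * (K * ‖x - y‖) := by
        refine (abs_add_le _ _).trans (add_le_add h1 ?_)
        rw [abs_mul, abs_of_nonneg h4]
        gcongr
    _ = (L₁ + d * K) * ‖x - y‖ := by ring

theorem norm_gradient_le_of_lipschitzWith {F : Type*} [NormedAddCommGroup F]
    [InnerProductSpace ℝ F] [CompleteSpace F] {f : F → ℝ} {L : NNReal}
    (hf : LipschitzWith L f) (x : F) : ‖gradient f x‖ ≤ L := by
  unfold gradient
  rw [LinearIsometryEquiv.norm_map]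
  exact norm_fderiv_le_of_lipschitz ℝ hf

theorem exists_forall_abs_profPhi_le (N : ℕ) {p β ε : ℝ} (hp : 3 < p)
    (hβ : β < 2 / (p - 1)) (hε0 : 0 < ε) (hε1 : ε < 1)
    {χ₀ : EuclideanSpace ℝ (Fin N) → ℝ} (hχ01 : ∀ z, 0 ≤ χ₀ z ∧ χ₀ z ≤ 1)
    (hχsupp : ∀ z, 2 ≤ ‖z‖ → χ₀ z = 0) :
    ∃ M > (0 : ℝ), ∀ s ≥ (1 : ℝ), ∀ y,
      |profPhi N p ε χ₀ s y| ≤ M * s ^ 2 * (1 + ‖y‖) ^ (-β) := by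
  have hp1 : 0 < p - 1 := by linarith
  have hp0 : 0 < p := by linarith
  unfold profPhi
  have hβa : β ≤ 2 * (1 / (p - 1)) := by rw [mul_one_div]; exact hβ.le
  have ha1 : 1 / (p - 1) ≤ 1 := by rw [div_le_one hp1]; linarith
  have hβ1 : β ≤ 1 := by
    refine hβ.le.trans ?_
    rw [div_le_one hp1]; linarith
  set a := 1 / (p - 1) with ha
  have ha0 : 0 < a := by positivity
  set b := (p - 1) ^ 2 / (4 * p) with hb
  have hb0 : 0 < b := by positivity
  set m := min (p - 1) b / 2 with hm
  have hm0 : 0 < m := by have := lt_min hp1 hb0; positivity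
  set d := (p - 1) ^ (-a) * N / (2 * p) with hd
  have hd0 : 0 ≤ d := by positivity
  refine ⟨m ^ (-a) + d * 3, by positivity, fun s hs y => ?_⟩
  have hs0 : 0 < s := by linarith
  have hr : 0 ≤ ‖y‖ := norm_nonneg y
  have hr1 : 1 ≤ 1 + ‖y‖ := by linarith
  have h1 : (p - 1 + b * ‖(√s)⁻¹ • y‖ ^ 2) ^ (-a) ≤ m ^ (-a) * s ^ 2 * (1 + ‖y‖) ^ (-β) := by
    have hn : ‖(√s)⁻¹ • y‖ ^ 2 = s⁻¹ * ‖y‖ ^ 2 := by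
      rw [norm_smul, mul_pow, norm_inv, inv_pow, Real.norm_eq_abs, sq_abs, Real.sq_sqrt hs0.le]
    have hlow : m * s⁻¹ * (1 + ‖y‖) ^ (2 : ℝ) ≤ p - 1 + b * ‖(√s)⁻¹ • y‖ ^ 2 := by
      rw [hn]
      have e1 : min (p - 1) b ≤ p - 1 := min_le_left _ _
      have e2 : min (p - 1) b ≤ b := min_le_right _ _
      have e3 : s⁻¹ ≤ 1 := inv_le_one_of_one_le₀ hs
      have e4 : 0 < s⁻¹ := by positivity
      have e5 : (1 + ‖y‖) ^ (2 : ℝ) ≤ 2 * (1 + ‖y‖ ^ 2) := by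
        norm_cast
        nlinarith [sq_nonneg (‖y‖ - 1)]
      calc m * s⁻¹ * (1 + ‖y‖) ^ (2 : ℝ) ≤ m * s⁻¹ * (2 * (1 + ‖y‖ ^ 2)) := by gcongr
        _ = min (p - 1) b * s⁻¹ + min (p - 1) b * (s⁻¹ * ‖y‖ ^ 2) := by rw [hm]; ring
        _ ≤ (p - 1) * 1 + b * (s⁻¹ * ‖y‖ ^ 2) := by gcongr
        _ = _ := by ring
    calc (p - 1 + b * ‖(√s)⁻¹ • y‖ ^ 2) ^ (-a)
        ≤ (m * s⁻¹ * (1 + ‖y‖) ^ (2 : ℝ)) ^ (-a) :=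
          Real.rpow_le_rpow_of_nonpos (by positivity) hlow (by linarith)
      _ = m ^ (-a) * s ^ a * (1 + ‖y‖) ^ (-(2 * a)) := by
          rw [Real.mul_rpow (by positivity) (by positivity),
            Real.mul_rpow (by positivity) (by positivity), ← Real.rpow_mul (by positivity),
            Real.rpow_neg (x := s⁻¹) (by positivity), Real.inv_rpow hs0.le, inv_inv]
          congr 2
          ring
      _ ≤ m ^ (-a) * s ^ 2 * (1 + ‖y‖) ^ (-β) := by
          have e6 : s ^ a ≤ s ^ 2 := by
            rw [← Real.rpow_two]
            exact Real.rpow_le_rpow_of_exponent_le hs (by linarith)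
          have e7 : (1 + ‖y‖) ^ (-(2 * a)) ≤ (1 + ‖y‖) ^ (-β) :=
            Real.rpow_le_rpow_of_exponent_le hr1 (by linarith)
          gcongr
  have hg1 : 1 ≤ s ^ (1 / 2 + ε) := Real.one_le_rpow hs (by linarith)
  have hg2 : s ^ (1 / 2 + ε) ≤ s ^ 2 := by
    rw [← Real.rpow_two]
    exact Real.rpow_le_rpow_of_exponent_le hs (by linarith)
  have h2 : χ₀ ((s ^ (1 / 2 + ε))⁻¹ • y) ≤ 3 * s ^ 2 * (1 + ‖y‖) ^ (-β) := by
    by_cases hy : 2 ≤ ‖(s ^ (1 / 2 + ε))⁻¹ • y‖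
    · rw [hχsupp _ hy]; positivity
    · refine (hχ01 _).2.trans ?_
      rw [norm_smul, norm_inv, Real.norm_eq_abs, abs_of_pos (by linarith), not_le,
        inv_mul_lt_iff₀ (by linarith)] at hy
      rw [Real.rpow_neg (by linarith), ← div_eq_mul_inv, le_div_iff₀ (by positivity), one_mul]
      calc (1 + ‖y‖) ^ β ≤ (1 + ‖y‖) ^ (1 : ℝ) := Real.rpow_le_rpow_of_exponent_le hr1 hβ1
        _ ≤ 3 * s ^ 2 := by rw [Real.rpow_one]; linarith
  have h3 : (p - 1) ^ (-a) * N / (2 * p * s) ≤ d := by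
    refine div_le_div_of_nonneg_left (by positivity) (by positivity) ?_
    exact le_mul_of_one_le_right (by positivity) hs
  have h4 : 0 ≤ (p - 1) ^ (-a) * N / (2 * p * s) := by positivity
  have h5 := (hχ01 ((s ^ (1 / 2 + ε))⁻¹ • y)).1
  rw [abs_of_nonneg (by positivity)]
  calc _ ≤ m ^ (-a) * s ^ 2 * (1 + ‖y‖) ^ (-β) + d * (3 * s ^ 2 * (1 + ‖y‖) ^ (-β)) := by gcongr
    _ = _ := by ring

theorem setIntegral_rpow_abs_le {N : ℕ} {β r M : ℝ} (hr : 0 < r) (hβ : N < β * r) (hM : 0 ≤ M)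
    {g : EuclideanSpace ℝ (Fin N) → ℝ} (hg : ∀ y, |g y| ≤ M * (1 + ‖y‖) ^ (-β))
    (S : Set (EuclideanSpace ℝ (Fin N))) :
    ∫ y in S, |g y| ^ r ≤
      M ^ r * ∫ y : EuclideanSpace ℝ (Fin N), (1 + ‖y‖) ^ (-(β * r)) := by
  have hint : Integrable fun y : EuclideanSpace ℝ (Fin N) => (1 + ‖y‖) ^ (-(β * r)) :=
    integrable_one_add_norm (by simpa using hβ)
  rw [← integral_const_mul]
  have hint' := hint.const_mul (M ^ r)
  refine (integral_mono_of_nonneg (.of_forall fun y => by positivity) hint'.integrableOn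
    (.of_forall fun y => ?_)).trans
    (setIntegral_le_integral hint' (.of_forall fun y => by positivity))
  calc |g y| ^ r ≤ (M * (1 + ‖y‖) ^ (-β)) ^ r := by
        gcongr
        exact hg y
    _ = M ^ r * (1 + ‖y‖) ^ (-(β * r)) := by
        rw [Real.mul_rpow hM (by positivity), ← Real.rpow_mul (by positivity), neg_mul]

theorem stmt_13 (N : ℕ) (hN : 1 ≤ N) (p q μ β ε : ℝ) (hp : 3 < p)
    (hq1 : (N : ℝ) * (p - 1) / 2 + 1 < q) (hq2 : q < (N : ℝ) * (p - 1) / 2 + (p + 1) / 2)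
    (hβ1 : (N : ℝ) / (q - 1) < β) (hβ2 : β < 2 / (p - 1))
    (hε0 : 0 < ε) (hε1 : ε < min 1 ((p - 1) / 4))
    (χ₀ : EuclideanSpace ℝ (Fin N) → ℝ) (hχ : ContDiff ℝ (⊤ : ℕ∞) χ₀)
    (hχ01 : ∀ z, 0 ≤ χ₀ z ∧ χ₀ z ≤ 1)
    (hχ1 : ∀ z, ‖z‖ ≤ 1 → χ₀ z = 1)
    (hχsupp : ∀ z, 2 ≤ ‖z‖ → χ₀ z = 0) :
    ∀ A ≥ (1 : ℝ), ∃ s₅ ≥ (1 : ℝ), ∃ C > (0 : ℝ), ∀ s ≥ s₅,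
      ∀ v : EuclideanSpace ℝ (Fin N) → ℝ, ContDiff ℝ 1 v →
      (∀ y, (1 + ‖y‖ ^ β) * |v y| ≤ A ^ 2 * s ^ (-((1 - β) / 2))) →
      (∀ y, ‖gradient v y‖ ≤ A ^ 2 * s ^ (-(1 / 2) : ℝ)) →
      (∀ y, (1 + ‖y‖ ^ β) * ‖gradient v y‖ ≤ A ^ 2 * s ^ (-((1 - β) / 2))) →
      ∀ y, |μ * Real.exp (-((p - q) / (p - 1) + ((N : ℝ) - 1) / 2) * s) *
          ‖gradient v y + gradient (profPhi N p ε χ₀ s) y‖ *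
          ∫ y' in Metric.ball (0 : EuclideanSpace ℝ (Fin N)) ‖y‖,
            |v y' + profPhi N p ε χ₀ s y'| ^ (q - 1)| ≤
        C * Real.exp (-((p - q) / (p - 1) + ((N : ℝ) - 1) / 2) * s / 2) := by
  intro A hA
  have hp1 : 0 < p - 1 := by linarith
  have hN1 : (1 : ℝ) ≤ N := by exact_mod_cast hN
  have hq0 : 0 < q - 1 := by
    have : 0 < (N : ℝ) * (p - 1) / 2 := by positivity
    linarith
  have hβ0 : 0 < β := lt_of_le_of_lt (by positivity) hβ1
  have hβ_one : β ≤ 1 := by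
    refine hβ2.le.trans ?_
    rw [div_le_one hp1]; linarith
  have hβq : (N : ℝ) < β * (q - 1) := by rwa [div_lt_iff₀ hq0] at hβ1
  have hγ : 0 < (p - q) / (p - 1) + ((N : ℝ) - 1) / 2 := by
    rw [div_add_div _ _ hp1.ne' two_ne_zero]
    apply div_pos _ (by linarith)
    nlinarith
  set γ := (p - q) / (p - 1) + ((N : ℝ) - 1) / 2 with hγ_def
  obtain ⟨K, hK⟩ : ∃ K, LipschitzWith K χ₀ := by
    refine hχ.lipschitzWith_of_hasCompactSupport ?_ (by simp)
    refine HasCompactSupport.intro (isCompact_closedBall 0 2) fun x hx => hχsupp x ?_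
    simpa using (not_le.mp (by simpa using hx)).le
  obtain ⟨L, hL⟩ := exists_forall_lipschitzWith_profPhi N (by linarith : 1 < p) hε0.le hK
  obtain ⟨M, hM0, hM⟩ := exists_forall_abs_profPhi_le N hp hβ2 hε0
    (hε1.trans_le (min_le_left _ _)) hχ01 hχsupp
  set J := ∫ y : EuclideanSpace ℝ (Fin N), (1 + ‖y‖) ^ (-(β * (q - 1))) with hJ
  have hJ0 : 0 ≤ J := integral_nonneg fun y => by positivity
  have hdecay := tendsto_rpow_mul_exp_neg_mul_atTop_nhds_zero (2 * (q - 1)) (γ / 2) (by linarith)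
  obtain ⟨s₀, hs₀⟩ := eventually_atTop.mp (hdecay.eventually_le_const zero_lt_one)
  set D := |μ| * (A ^ 2 + L) * ((A ^ 2 + M) ^ (q - 1) * J) with hD
  have hD0 : 0 ≤ D := by positivity
  refine ⟨max 1 s₀, le_max_left _ _, D + 1, by linarith, fun s hs v _ hv hv' _ y => ?_⟩
  have hs1 : 1 ≤ s := (le_max_left _ _).trans hs
  have hs0 : 0 < s := by linarith
  have hgrad : ‖gradient v y + gradient (profPhi N p ε χ₀ s) y‖ ≤ A ^ 2 + L := by
    refine (norm_add_le _ _).trans (add_le_add ((hv' y).trans ?_)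
      (norm_gradient_le_of_lipschitzWith (hL s hs1) y))
    exact mul_le_of_le_one_right (by positivity)
      (Real.rpow_le_one_of_one_le_of_nonpos hs1 (by norm_num))
  have hsum (y') : |v y' + profPhi N p ε χ₀ s y'| ≤
      (A ^ 2 + M) * s ^ 2 * (1 + ‖y'‖) ^ (-β) := by
    have h1 : |v y'| ≤ A ^ 2 * s ^ 2 * (1 + ‖y'‖) ^ (-β) := by
      rw [Real.rpow_neg (by positivity), ← div_eq_mul_inv, le_div_iff₀ (by positivity)]
      have h2 : (1 + ‖y'‖) ^ β ≤ 1 + ‖y'‖ ^ β := by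
        simpa using Real.rpow_add_le_add_rpow zero_le_one (norm_nonneg y') hβ0.le hβ_one
      have h3 : s ^ (-((1 - β) / 2)) ≤ 1 :=
        Real.rpow_le_one_of_one_le_of_nonpos hs1 (by linarith)
      have h4 : 1 ≤ s ^ 2 := one_le_pow₀ hs1
      calc |v y'| * (1 + ‖y'‖) ^ β ≤ |v y'| * (1 + ‖y'‖ ^ β) := by gcongr
        _ = (1 + ‖y'‖ ^ β) * |v y'| := mul_comm _ _
        _ ≤ A ^ 2 * s ^ (-((1 - β) / 2)) := hv y'
        _ ≤ A ^ 2 * s ^ 2 := by gcongr; exact h3.trans h4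
    refine (abs_add_le _ _).trans ((add_le_add h1 (hM s hs1 y')).trans_eq ?_)
    ring
  have hint := setIntegral_rpow_abs_le hq0 hβq (by positivity) hsum (Metric.ball 0 ‖y‖)
  have hint0 : 0 ≤ ∫ y' in Metric.ball (0 : EuclideanSpace ℝ (Fin N)) ‖y‖,
      |v y' + profPhi N p ε χ₀ s y'| ^ (q - 1) := integral_nonneg fun _ => by positivity
  rw [← hJ, Real.mul_rpow (by positivity) (by positivity), ← Real.rpow_two s,
    ← Real.rpow_mul hs0.le] at hint
  have hexp : Real.exp (-γ * s) = Real.exp (-(γ / 2) * s) * Real.exp (-γ * s / 2) := by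
    rw [← Real.exp_add]
    congr 1
    ring
  rw [abs_mul, abs_mul, abs_mul, abs_of_nonneg hint0, abs_norm, Real.abs_exp]
  calc _ ≤ |μ| * Real.exp (-γ * s) * (A ^ 2 + L) *
        ((A ^ 2 + M) ^ (q - 1) * s ^ (2 * (q - 1)) * J) := by
        gcongr
    _ = D * (s ^ (2 * (q - 1)) * Real.exp (-(γ / 2) * s)) * Real.exp (-γ * s / 2) := by
        rw [hexp]
        ring
    _ ≤ D * 1 * Real.exp (-γ * s / 2) := by
        gcongr
        exact hs₀ s ((le_max_right _ _).trans hs)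
    _ ≤ (D + 1) * Real.exp (-γ * s / 2) := by
        gcongr
        linarith
end

section
/- Let N ≥ 1, p > 3, N(p−1)/2 + 1 < q < N(p−1)/2 + (p+1)/2, μ ∈ ℝ, N/(q−1) < β < 2/(p−1), 0 < ε < min(1, (p−1)/4), and K₀ ≥ 1; set γ = (p−q)/(p−1) + (N−1)/2. Then for every A ≥ 1 there exist s₅ ≥ 1 and C > 0 such that the following holds for all s ≥ s₅: if v : ℝ^N → ℝ is a C¹ function satisfying sup_y (1+|y|^β)|v(y)| ≤ A² s^{−(1−β)/2}, sup_y |∇v(y)| ≤ A² s^{−1/2}, and sup_y (1+|y|^β)|∇v(y)| ≤ A² s^{−(1−β)/2}, then the function N(y,s) = μ e^{−γs} |∇v(y) + ∇_y φ(y,s)| ∫_{B(0,|y|)} |v(y′) + φ(y′,s)|^{q−1} dy′ satisfies sup_{y∈ℝ^N} (1 + |y|^β)(1 − χ(y,s)) |N(y,s)| ≤ C e^{−γ s/2}, where χ(y,s) = χ₀(|y|/(K₀√s)). -/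
open MeasureTheory Real

/-- The profile `φ(y,s) = f(y/√s) + (κN/(2ps)) χ₀(|y|/g_ε(s))` on `ℝ^N`, with a radial
cutoff `χ₀ : ℝ → ℝ`, where `f(z) = (p-1+b|z|²)^{-1/(p-1)}`, `b = (p-1)²/(4p)`,
`κ = (p-1)^{-1/(p-1)}`, `g_ε(s) = s^{1/2+ε}`. -/
noncomputable def profPhiR (N : ℕ) (p ε : ℝ) (χ₀ : ℝ → ℝ)
    (s : ℝ) (y : EuclideanSpace ℝ (Fin N)) : ℝ :=
  (p - 1 + (p - 1) ^ 2 / (4 * p) * ‖(Real.sqrt s)⁻¹ • y‖ ^ 2) ^ (-(1 / (p - 1))) +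
    (p - 1) ^ (-(1 / (p - 1))) * N / (2 * p * s) * χ₀ (‖y‖ / s ^ (1 / 2 + ε))

/-- Lower bounding the base of a decaying power by a multiple of `(1 + r²) / s`. -/
lemma rpow_neg_base_le {P b m a β s r : ℝ} (hm : 0 < m) (hmP : m ≤ P) (hmb : m ≤ b)
    (ha : 0 ≤ a) (ha1 : a ≤ 1) (hβ : β / 2 ≤ a) (hs : 1 ≤ s) :
    (P + b * ((Real.sqrt s)⁻¹ * r) ^ 2) ^ (-a) ≤
      m ^ (-a) * s ^ 4 * (1 + r ^ 2) ^ (-(β / 2)) := by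
  have hs0 : 0 < s := by linarith
  have hbase : m * (s⁻¹ * (1 + r ^ 2)) ≤ P + b * ((Real.sqrt s)⁻¹ * r) ^ 2 := by
    rw [mul_pow, inv_pow, Real.sq_sqrt hs0.le, mul_add, mul_add, mul_one]
    gcongr
    calc m * s⁻¹ ≤ m * 1 := by gcongr; exact inv_le_one_of_one_le₀ hs
      _ ≤ P := by linarith
  calc (P + b * ((Real.sqrt s)⁻¹ * r) ^ 2) ^ (-a)
      ≤ (m * (s⁻¹ * (1 + r ^ 2))) ^ (-a) :=
        Real.rpow_le_rpow_of_nonpos (by positivity) hbase (by linarith)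
    _ = m ^ (-a) * s ^ a * (1 + r ^ 2) ^ (-a) := by
        rw [Real.mul_rpow hm.le (by positivity), Real.mul_rpow (by positivity) (by positivity),
          Real.inv_rpow hs0.le, Real.rpow_neg hs0.le, inv_inv, mul_assoc]
    _ ≤ m ^ (-a) * s ^ 4 * (1 + r ^ 2) ^ (-(β / 2)) := by
        gcongr
        · rw [← Real.rpow_natCast s 4]
          exact Real.rpow_le_rpow_of_exponent_le hs (by norm_num; linarith)
        · nlinarith [sq_nonneg r]

/-- A bounded function supported in `[-2, 2]`, dilated by `s ^ (1 / 2 + ε)`, decays like any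
power up to a polynomial loss in `s`. -/
lemma abs_dilated_le {h : ℝ → ℝ} {M ε β s r : ℝ} (hM : ∀ z, |h z| ≤ M)
    (hsupp : Function.support h ⊆ Set.Icc (-2 : ℝ) 2) (hε0 : 0 < ε) (hε1 : ε < 1)
    (hβ1 : β < 1) (hs : 1 ≤ s) (hr : 0 ≤ r) :
    |h (r / s ^ (1 / 2 + ε))| ≤ M * 5 * s ^ 4 * (1 + r ^ 2) ^ (-(β / 2)) := by
  have hM0 : 0 ≤ M := (abs_nonneg _).trans (hM 0)
  have hs0 : 0 < s := by linarith
  by_cases h0 : h (r / s ^ (1 / 2 + ε)) = 0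
  · rw [h0, abs_zero]; positivity
  have hmem := (hsupp h0).2
  have hg : 0 < s ^ (1 / 2 + ε) := by positivity
  rw [div_le_iff₀ hg] at hmem
  have hgs : s ^ (1 / 2 + ε) ≤ s ^ 2 := by
    rw [← Real.rpow_natCast s 2]
    exact Real.rpow_le_rpow_of_exponent_le hs (by norm_num; linarith)
  have hs4 : 1 ≤ s ^ 4 := one_le_pow₀ hs
  have hr2 : 1 + r ^ 2 ≤ 5 * s ^ 4 := by
    have : r ≤ 2 * s ^ 2 := by linarith
    nlinarith [mul_self_le_mul_self hr this]
  have hW : (1 + r ^ 2) ^ (β / 2) ≤ 5 * s ^ 4 :=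
    calc (1 + r ^ 2) ^ (β / 2) ≤ (1 + r ^ 2) ^ (1 : ℝ) :=
          Real.rpow_le_rpow_of_exponent_le (by nlinarith [sq_nonneg r]) (by linarith)
      _ ≤ 5 * s ^ 4 := by rwa [Real.rpow_one]
  have hpos : 0 < (1 + r ^ 2) ^ (β / 2) := by positivity
  rw [Real.rpow_neg (by positivity), ← div_eq_mul_inv, le_div_iff₀ hpos]
  calc _ ≤ M * (5 * s ^ 4) := by gcongr; exact hM _
    _ = _ := by ring

lemma one_add_rpow_mul_le_two {β r : ℝ} (hβ0 : 0 < β) (hr : 0 ≤ r) :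
    (1 + r ^ β) * (1 + r ^ 2) ^ (-(β / 2)) ≤ 2 := by
  have hpos : 0 < (1 + r ^ 2) ^ (β / 2) := by positivity
  rw [Real.rpow_neg (by positivity), ← div_eq_mul_inv, div_le_iff₀ hpos]
  have h1 : 1 ≤ (1 + r ^ 2) ^ (β / 2) :=
    Real.one_le_rpow (by nlinarith [sq_nonneg r]) (by linarith)
  have h2 : r ^ β ≤ (1 + r ^ 2) ^ (β / 2) := by
    calc r ^ β = (r ^ 2) ^ (β / 2) := by
          rw [← Real.rpow_natCast, ← Real.rpow_mul hr]; congr 1; push_cast; ring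
      _ ≤ _ := by gcongr; linarith
  linarith

lemma one_add_sq_rpow_le {β r : ℝ} (hβ0 : 0 < β) (hβ1 : β < 1) (hr : 0 ≤ r) :
    (1 + r ^ 2) ^ (β / 2) ≤ 1 + r ^ β := by
  have h := Real.rpow_add_le_add_rpow (zero_le_one) (sq_nonneg r)
    (by linarith : 0 ≤ β / 2) (by linarith : β / 2 ≤ 1)
  rw [Real.one_rpow, ← Real.rpow_natCast r 2, ← Real.rpow_mul hr] at h
  rw [← Real.rpow_natCast r 2]
  convert h using 3
  push_cast; ring

/-- The gradient of a radial function is controlled by the derivative of its profile. -/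
lemma norm_gradient_radial_le {E : Type*} [NormedAddCommGroup E] [InnerProductSpace ℝ E]
    [CompleteSpace E] {F : ℝ → ℝ} {F' : ℝ} {y : E} (hy : y ≠ 0)
    (hF : HasDerivAt F F' ‖y‖) : ‖gradient (fun x : E => F ‖x‖) y‖ ≤ |F'| := by
  have hn : DifferentiableAt ℝ (fun x : E => ‖x‖) y :=
    (contDiffAt_norm ℝ hy (n := 1)).differentiableAt (by norm_num)
  have hc := hF.comp_hasFDerivAt y hn.hasFDerivAt
  have hl : ‖fderiv ℝ (fun x : E => ‖x‖) y‖ ≤ 1 := by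
    simpa using norm_fderiv_le_of_lipschitz ℝ (lipschitzWith_one_norm (E := E)) (x₀ := y)
  have he : fderiv ℝ (fun x : E => F ‖x‖) y = F' • fderiv ℝ (fun x : E => ‖x‖) y := hc.fderiv
  rw [gradient, LinearIsometryEquiv.norm_map, he, norm_smul, Real.norm_eq_abs]
  exact mul_le_of_le_one_right (abs_nonneg _) hl

/-- Pointwise decay of the profile and of its gradient, up to a polynomial loss in `s`. -/
lemma exists_profPhiR_bound (N : ℕ) {p β ε : ℝ} (hp : 3 < p)
    (hβ2 : β < 2 / (p - 1)) (hε0 : 0 < ε) (hε1 : ε < 1)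
    {χ₀ : ℝ → ℝ} (hχ : ContDiff ℝ (⊤ : ℕ∞) χ₀) (hχ01 : ∀ z, 0 ≤ χ₀ z ∧ χ₀ z ≤ 1)
    (hχsupp : Function.support χ₀ ⊆ Set.Icc (-2 : ℝ) 2) :
    ∃ C > (0 : ℝ), ∀ s ≥ (1 : ℝ), ∀ y : EuclideanSpace ℝ (Fin N),
      |profPhiR N p ε χ₀ s y| ≤ C * s ^ 4 * (1 + ‖y‖ ^ 2) ^ (-(β / 2)) ∧
      (1 ≤ ‖y‖ → ‖gradient (profPhiR N p ε χ₀ s) y‖ ≤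
        C * s ^ 4 * (1 + ‖y‖ ^ 2) ^ (-(β / 2))) := by
  have hβ1 : β < 1 := hβ2.trans (by rw [div_lt_one] <;> linarith)
  have hcs : HasCompactSupport χ₀ := HasCompactSupport.of_support_subset_isCompact
    isCompact_Icc hχsupp
  have hd : ContDiff ℝ 1 χ₀ := hχ.of_le (by exact_mod_cast le_top)
  obtain ⟨M, hM⟩ := hcs.deriv.exists_bound_of_continuous (hd.continuous_deriv le_rfl)
  have hM0 : 0 ≤ M := (norm_nonneg _).trans (hM 0)
  have hdsupp : Function.support (deriv χ₀) ⊆ Set.Icc (-2 : ℝ) 2 :=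
    support_deriv_subset.trans (closure_minimal hχsupp isClosed_Icc)
  set a : ℝ := 1 / (p - 1) with ha_def
  have ha0 : 0 < a := by rw [ha_def]; apply one_div_pos.2; linarith
  have ha1 : a ≤ 1 := by rw [ha_def, div_le_one] <;> linarith
  have hβa : β / 2 ≤ a := by
    have : 2 / (p - 1) = 2 * a := by rw [ha_def]; ring
    linarith
  have hP : 0 < p - 1 := by linarith
  set b : ℝ := (p - 1) ^ 2 / (4 * p) with hb_def
  have hb0 : 0 < b := by rw [hb_def]; positivity
  set m : ℝ := min (p - 1) b
  have hm0 : 0 < m := lt_min hP hb0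
  set c₀ : ℝ := (p - 1) ^ (-a) * N / (2 * p) with hc₀_def
  have hc₀ : 0 ≤ c₀ := by rw [hc₀_def]; positivity
  refine ⟨2 * m ^ (-a) + c₀ * (1 + M) * 5, by positivity, fun s hs y => ?_⟩
  have hs0 : 0 < s := by linarith
  set w : ℝ := (1 + ‖y‖ ^ 2) ^ (-(β / 2))
  have hw0 : 0 ≤ w := by positivity
  set c : ℝ := (p - 1) ^ (-a) * N / (2 * p * s) with hc_def
  have hc : 0 ≤ c := by rw [hc_def]; positivity
  have hcc₀ : c ≤ c₀ := by
    rw [hc_def, hc₀_def]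
    apply div_le_div_of_nonneg_left (by positivity) (by positivity)
    nlinarith
  set g : ℝ := s ^ (1 / 2 + ε)
  have hg1 : 1 ≤ g := Real.one_le_rpow hs (by linarith)
  set D : ℝ → ℝ := fun r => p - 1 + b * ((Real.sqrt s)⁻¹ * r) ^ 2 with hD_def
  have hD0 : ∀ r, 0 < D r := fun r => by simp only [hD_def]; positivity
  set F : ℝ → ℝ := fun r => D r ^ (-a) + c * χ₀ (r / g) with hF_def
  have hprof : profPhiR N p ε χ₀ s = fun x => F ‖x‖ := by
    funext x
    simp only [profPhiR, hF_def, hD_def, norm_smul, norm_inv, Real.norm_eq_abs,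
      abs_of_nonneg (Real.sqrt_nonneg s)]
    rfl
  have hDw : D ‖y‖ ^ (-a) ≤ m ^ (-a) * s ^ 4 * w :=
    rpow_neg_base_le hm0 (min_le_left _ _) (min_le_right _ _) ha0.le ha1 hβa hs
  have hK : 0 ≤ m ^ (-a) * s ^ 4 * w := by positivity
  have hS1 : 0 ≤ c₀ * (s ^ 4 * w) := by positivity
  have hS2 : 0 ≤ c₀ * M * (s ^ 4 * w) := by positivity
  refine ⟨?_, fun hy => ?_⟩
  · have h1 : |χ₀ (‖y‖ / g)| ≤ 1 * 5 * s ^ 4 * w :=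
      abs_dilated_le (fun z => by rw [abs_of_nonneg (hχ01 z).1]; exact (hχ01 z).2)
        hχsupp hε0 hε1 hβ1 hs (norm_nonneg y)
    rw [hprof]
    calc |F ‖y‖| ≤ |D ‖y‖ ^ (-a)| + |c * χ₀ (‖y‖ / g)| := abs_add_le _ _
      _ = D ‖y‖ ^ (-a) + c * |χ₀ (‖y‖ / g)| := by
        rw [abs_of_nonneg (Real.rpow_nonneg (hD0 _).le _), abs_mul, abs_of_nonneg hc]
      _ ≤ m ^ (-a) * s ^ 4 * w + c₀ * (1 * 5 * s ^ 4 * w) := by gcongr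
      _ ≤ _ := by linarith
  · have h1 : |deriv χ₀ (‖y‖ / g)| ≤ M * 5 * s ^ 4 * w :=
      abs_dilated_le hM hdsupp hε0 hε1 hβ1 hs (norm_nonneg y)
    have hy0 : y ≠ 0 := norm_pos_iff.1 (by linarith)
    have hDd : HasDerivAt D (b * (2 * ((Real.sqrt s)⁻¹ * ‖y‖) * (Real.sqrt s)⁻¹)) ‖y‖ := by
      have := ((((hasDerivAt_id ‖y‖).const_mul (Real.sqrt s)⁻¹).pow 2).const_mul b).const_add
        (p - 1)
      refine this.congr_deriv ?_
      norm_num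
    have hχd : HasDerivAt (fun r => c * χ₀ (r / g)) (c * (deriv χ₀ (‖y‖ / g) * (1 / g))) ‖y‖ :=
      (((hd.differentiable (by norm_num)) (‖y‖ / g)).hasDerivAt.comp ‖y‖
        ((hasDerivAt_id ‖y‖).div_const g)).const_mul c
    have hFd := (hDd.rpow_const (p := -a) (Or.inl (hD0 _).ne')).add hχd
    have hgrad := norm_gradient_radial_le hy0 hFd
    rw [hprof]
    refine hgrad.trans ((abs_add_le _ _).trans ?_)
    have hA : |b * (2 * ((Real.sqrt s)⁻¹ * ‖y‖) * (Real.sqrt s)⁻¹) * -a * D ‖y‖ ^ (-a - 1)| ≤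
        2 * D ‖y‖ ^ (-a) := by
      have hq : 0 ≤ b * (2 * ((Real.sqrt s)⁻¹ * ‖y‖) * (Real.sqrt s)⁻¹) := by positivity
      have hle : b * (2 * ((Real.sqrt s)⁻¹ * ‖y‖) * (Real.sqrt s)⁻¹) ≤ 2 * D ‖y‖ := by
        simp only [hD_def]
        have : b * (2 * ((Real.sqrt s)⁻¹ * ‖y‖) * (Real.sqrt s)⁻¹) ≤
            b * (2 * ((Real.sqrt s)⁻¹ * ‖y‖) * ((Real.sqrt s)⁻¹ * ‖y‖)) := by
          gcongr
          exact le_mul_of_one_le_right (by positivity) hy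
        nlinarith
      have hpow : D ‖y‖ ^ (-a) = D ‖y‖ * D ‖y‖ ^ (-a - 1) := by
        rw [Real.rpow_sub_one (hD0 _).ne']
        field_simp [(hD0 ‖y‖).ne']
      rw [abs_mul, abs_mul, abs_neg, abs_of_nonneg hq, abs_of_pos ha0,
        abs_of_nonneg (Real.rpow_nonneg (hD0 _).le _), hpow, ← mul_assoc 2 (D ‖y‖)]
      exact mul_le_mul_of_nonneg_right ((mul_le_of_le_one_right hq ha1).trans hle)
        (Real.rpow_nonneg (hD0 _).le _)
    have hB : |c * (deriv χ₀ (‖y‖ / g) * (1 / g))| ≤ c₀ * (M * 5 * s ^ 4 * w) := by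
      rw [abs_mul, abs_of_nonneg hc, abs_mul, abs_of_nonneg (by positivity : 0 ≤ 1 / g)]
      refine mul_le_mul hcc₀ ((mul_le_of_le_one_right (abs_nonneg _) ?_).trans h1)
        (by positivity) hc₀
      rw [div_le_one] <;> linarith
    calc _ ≤ 2 * (m ^ (-a) * s ^ 4 * w) + c₀ * (M * 5 * s ^ 4 * w) :=
          add_le_add (hA.trans (by gcongr)) hB
      _ ≤ _ := by linarith

/-- Half of an exponential decay absorbs a polynomial growth. -/
lemma cutoff_product_le {W T μ γ s B q G J I : ℝ} (hT0 : 0 ≤ T) (hT1 : T ≤ 1) (hB : 0 < B)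
    (hs : 0 < s) (hG0 : 0 ≤ G) (hJ0 : 0 ≤ J) (hI : 0 ≤ I)
    (hG : W * G ≤ 2 * B * s ^ 4) (hJ : J ≤ (B * s ^ 4) ^ (q - 1) * I)
    (hdecay : s ^ (4 * q) * Real.exp (-(γ / 2) * s) ≤ 1) :
    W * T * |μ * Real.exp (-γ * s) * G * J| ≤
      (|μ| * (2 * B * (B ^ (q - 1) * I)) + 1) * Real.exp (-γ * s / 2) := by
  have hexp : Real.exp (-γ * s) = Real.exp (-(γ / 2) * s) * Real.exp (-γ * s / 2) := by
    rw [← Real.exp_add]; congr 1; ring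
  have hspow : s ^ 4 * (B * s ^ 4) ^ (q - 1) = B ^ (q - 1) * s ^ (4 * q) := by
    rw [Real.mul_rpow hB.le (by positivity), ← Real.rpow_natCast s 4, ← Real.rpow_mul hs.le,
      mul_left_comm, ← Real.rpow_add hs]
    congr 2
    push_cast; ring
  have hGJ : W * G * J ≤ (2 * B * s ^ 4) * ((B * s ^ 4) ^ (q - 1) * I) :=
    mul_le_mul hG hJ hJ0 (by positivity)
  rw [abs_mul, abs_mul, abs_mul, abs_of_pos (Real.exp_pos _), abs_of_nonneg hG0,
    abs_of_nonneg hJ0]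
  calc W * T * (|μ| * Real.exp (-γ * s) * G * J)
      = T * (|μ| * Real.exp (-γ * s)) * (W * G * J) := by ring
    _ ≤ T * (|μ| * Real.exp (-γ * s)) * ((2 * B * s ^ 4) * ((B * s ^ 4) ^ (q - 1) * I)) :=
      mul_le_mul_of_nonneg_left hGJ (by positivity)
    _ ≤ 1 * (|μ| * Real.exp (-γ * s)) * ((2 * B * s ^ 4) * ((B * s ^ 4) ^ (q - 1) * I)) := by
      gcongr
    _ = |μ| * (2 * B * (B ^ (q - 1) * I)) * (s ^ (4 * q) * Real.exp (-(γ / 2) * s)) *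
        Real.exp (-γ * s / 2) := by
      rw [hexp]; linear_combination (|μ| * (Real.exp (-(γ / 2) * s) * Real.exp (-γ * s / 2)) *
        (2 * B * I)) * hspow
    _ ≤ |μ| * (2 * B * (B ^ (q - 1) * I)) * 1 * Real.exp (-γ * s / 2) := by
      gcongr
    _ ≤ (|μ| * (2 * B * (B ^ (q - 1) * I)) + 1) * Real.exp (-γ * s / 2) := by
      rw [mul_one]
      exact mul_le_mul_of_nonneg_right (lt_add_one _).le (Real.exp_pos _).le

theorem stmt_14 (N : ℕ) (hN : 1 ≤ N) (p q μ β ε K₀ : ℝ) (hp : 3 < p)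
    (hq1 : (N : ℝ) * (p - 1) / 2 + 1 < q) (hq2 : q < (N : ℝ) * (p - 1) / 2 + (p + 1) / 2)
    (hβ1 : (N : ℝ) / (q - 1) < β) (hβ2 : β < 2 / (p - 1))
    (hε0 : 0 < ε) (hε1 : ε < min 1 ((p - 1) / 4)) (hK₀ : 1 ≤ K₀)
    (χ₀ : ℝ → ℝ) (hχ : ContDiff ℝ (⊤ : ℕ∞) χ₀)
    (hχ01 : ∀ z, 0 ≤ χ₀ z ∧ χ₀ z ≤ 1)
    (hχ1 : ∀ z ∈ Set.Icc (-1 : ℝ) 1, χ₀ z = 1)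
    (hχsupp : Function.support χ₀ ⊆ Set.Icc (-2 : ℝ) 2) :
    ∀ A ≥ (1 : ℝ), ∃ s₅ ≥ (1 : ℝ), ∃ C > (0 : ℝ), ∀ s ≥ s₅,
      ∀ v : EuclideanSpace ℝ (Fin N) → ℝ, ContDiff ℝ 1 v →
      (∀ y, (1 + ‖y‖ ^ β) * |v y| ≤ A ^ 2 * s ^ (-((1 - β) / 2))) →
      (∀ y, ‖gradient v y‖ ≤ A ^ 2 * s ^ (-(1 / 2) : ℝ)) →
      (∀ y, (1 + ‖y‖ ^ β) * ‖gradient v y‖ ≤ A ^ 2 * s ^ (-((1 - β) / 2))) →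
      ∀ y, (1 + ‖y‖ ^ β) * (1 - χ₀ (‖y‖ / (K₀ * Real.sqrt s))) *
          |μ * Real.exp (-((p - q) / (p - 1) + ((N : ℝ) - 1) / 2) * s) *
            ‖gradient v y + gradient (profPhiR N p ε χ₀ s) y‖ *
            ∫ y' in Metric.ball (0 : EuclideanSpace ℝ (Fin N)) ‖y‖,
              |v y' + profPhiR N p ε χ₀ s y'| ^ (q - 1)| ≤
        C * Real.exp (-((p - q) / (p - 1) + ((N : ℝ) - 1) / 2) * s / 2) := by
  intro A hA
  have hN1 : (1 : ℝ) ≤ N := by exact_mod_cast hN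
  have hq : 0 < q - 1 := by nlinarith
  have hβ0 : 0 < β := lt_of_le_of_lt (by positivity) hβ1
  have hβlt : β < 1 := hβ2.trans (by rw [div_lt_one] <;> linarith)
  have hr : (N : ℝ) < β * (q - 1) := by rwa [div_lt_iff₀ hq] at hβ1
  set γ : ℝ := (p - q) / (p - 1) + ((N : ℝ) - 1) / 2 with hγ_def
  have hγ : 0 < γ := by
    have hp1 : 0 < p - 1 := by linarith
    have : γ = (N * (p - 1) / 2 + (p + 1) / 2 - q) / (p - 1) := by
      rw [hγ_def]; field_simp; ring
    rw [this]
    exact div_pos (by linarith) hp1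
  obtain ⟨C₁, hC₁, hprof⟩ := exists_profPhiR_bound N hp hβ2 hε0
    (hε1.trans_le (min_le_left _ _)) hχ hχ01 hχsupp
  have hint : Integrable (fun x : EuclideanSpace ℝ (Fin N) =>
      (1 + ‖x‖ ^ 2) ^ (-(β * (q - 1)) / 2)) volume :=
    integrable_rpow_neg_one_add_norm_sq (by simpa using hr)
  set I : ℝ := ∫ x : EuclideanSpace ℝ (Fin N), (1 + ‖x‖ ^ 2) ^ (-(β * (q - 1)) / 2)
  have hI : 0 ≤ I := integral_nonneg fun x => by positivity
  set B : ℝ := A ^ 2 + C₁ with hB_def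
  have hB : 0 < B := by positivity
  obtain ⟨s₀, hs₀⟩ := Filter.eventually_atTop.1 <|
    (tendsto_rpow_mul_exp_neg_mul_atTop_nhds_zero (4 * q) (γ / 2) (by positivity)).eventually
      (eventually_le_nhds zero_lt_one)
  refine ⟨max 1 s₀, le_max_left _ _, |μ| * (2 * B * (B ^ (q - 1) * I)) + 1, by positivity,
    fun s hs v _ hv _ hgv y => ?_⟩
  have hs1 : 1 ≤ s := (le_max_left _ _).trans hs
  have hs0 : 0 < s := by linarith
  have hs4 : 1 ≤ s ^ 4 := one_le_pow₀ hs1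
  have hAs : A ^ 2 * s ^ (-((1 - β) / 2)) ≤ A ^ 2 :=
    mul_le_of_le_one_right (by positivity) (Real.rpow_le_one_of_one_le_of_nonpos hs1 (by linarith))
  by_cases hy : ‖y‖ ≤ K₀ * Real.sqrt s
  · have h1 : χ₀ (‖y‖ / (K₀ * Real.sqrt s)) = 1 :=
      hχ1 _ ⟨by linarith [show 0 ≤ ‖y‖ / (K₀ * Real.sqrt s) by positivity],
        div_le_one_of_le₀ hy (by positivity)⟩
    rw [h1, sub_self, mul_zero, zero_mul]
    positivity
  have hy1 : 1 ≤ ‖y‖ := by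
    have : 1 ≤ Real.sqrt s := Real.one_le_sqrt.2 hs1
    nlinarith
  have hvw : ∀ x, |v x| ≤ A ^ 2 * (1 + ‖x‖ ^ 2) ^ (-(β / 2)) := fun x => by
    rw [Real.rpow_neg (by positivity), ← div_eq_mul_inv, le_div_iff₀ (by positivity), mul_comm]
    calc _ ≤ (1 + ‖x‖ ^ β) * |v x| := by
          gcongr; exact one_add_sq_rpow_le hβ0 hβlt (norm_nonneg x)
      _ ≤ A ^ 2 := (hv x).trans hAs
  have hsum : ∀ x, |v x + profPhiR N p ε χ₀ s x| ≤
      B * s ^ 4 * (1 + ‖x‖ ^ 2) ^ (-(β / 2)) := fun x => by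
    calc _ ≤ |v x| + |profPhiR N p ε χ₀ s x| := abs_add_le _ _
      _ ≤ A ^ 2 * (1 + ‖x‖ ^ 2) ^ (-(β / 2)) +
          C₁ * s ^ 4 * (1 + ‖x‖ ^ 2) ^ (-(β / 2)) := add_le_add (hvw x) (hprof s hs1 x).1
      _ ≤ A ^ 2 * s ^ 4 * (1 + ‖x‖ ^ 2) ^ (-(β / 2)) +
          C₁ * s ^ 4 * (1 + ‖x‖ ^ 2) ^ (-(β / 2)) := by
        gcongr
        exact le_mul_of_one_le_right (by positivity) hs4
      _ = _ := by rw [hB_def]; ring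
  have hpow : ∀ x, |v x + profPhiR N p ε χ₀ s x| ^ (q - 1) ≤
      (B * s ^ 4) ^ (q - 1) * (1 + ‖x‖ ^ 2) ^ (-(β * (q - 1)) / 2) := fun x => by
    refine (Real.rpow_le_rpow (abs_nonneg _) (hsum x) hq.le).trans_eq ?_
    rw [Real.mul_rpow (by positivity) (by positivity), ← Real.rpow_mul (by positivity)]
    congr 2
    ring
  have hJ : ∫ x in Metric.ball (0 : EuclideanSpace ℝ (Fin N)) ‖y‖,
      |v x + profPhiR N p ε χ₀ s x| ^ (q - 1) ≤ (B * s ^ 4) ^ (q - 1) * I := by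
    have hi := hint.const_mul ((B * s ^ 4) ^ (q - 1))
    calc _ ≤ ∫ x in Metric.ball (0 : EuclideanSpace ℝ (Fin N)) ‖y‖,
          (B * s ^ 4) ^ (q - 1) * (1 + ‖x‖ ^ 2) ^ (-(β * (q - 1)) / 2) :=
          integral_mono_of_nonneg (Filter.Eventually.of_forall fun x => by positivity)
            hi.integrableOn (Filter.Eventually.of_forall hpow)
      _ ≤ ∫ x : EuclideanSpace ℝ (Fin N),
          (B * s ^ 4) ^ (q - 1) * (1 + ‖x‖ ^ 2) ^ (-(β * (q - 1)) / 2) :=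
          setIntegral_le_integral hi (Filter.Eventually.of_forall fun x => by positivity)
      _ = _ := integral_const_mul _ _
  set J : ℝ := ∫ x in Metric.ball (0 : EuclideanSpace ℝ (Fin N)) ‖y‖,
      |v x + profPhiR N p ε χ₀ s x| ^ (q - 1)
  have hJ0 : 0 ≤ J := integral_nonneg fun x => by positivity
  set G : ℝ := ‖gradient v y + gradient (profPhiR N p ε χ₀ s) y‖
  have hG : (1 + ‖y‖ ^ β) * G ≤ 2 * B * s ^ 4 := by
    have h2 : (1 + ‖y‖ ^ β) * ‖gradient (profPhiR N p ε χ₀ s) y‖ ≤ C₁ * s ^ 4 * 2 := by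
      calc _ ≤ (1 + ‖y‖ ^ β) * (C₁ * s ^ 4 * (1 + ‖y‖ ^ 2) ^ (-(β / 2))) := by
            gcongr; exact (hprof s hs1 y).2 hy1
        _ = C₁ * s ^ 4 * ((1 + ‖y‖ ^ β) * (1 + ‖y‖ ^ 2) ^ (-(β / 2))) := by ring
        _ ≤ _ := by gcongr; exact one_add_rpow_mul_le_two hβ0 (norm_nonneg y)
    have h3 : A ^ 2 ≤ A ^ 2 * s ^ 4 := le_mul_of_one_le_right (by positivity) hs4
    calc (1 + ‖y‖ ^ β) * G ≤ (1 + ‖y‖ ^ β) *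
          (‖gradient v y‖ + ‖gradient (profPhiR N p ε χ₀ s) y‖) := by
          gcongr; exact norm_add_le _ _
      _ ≤ A ^ 2 + C₁ * s ^ 4 * 2 := by
          rw [mul_add]; exact add_le_add ((hgv y).trans hAs) h2
      _ ≤ _ := by rw [hB_def]; nlinarith [sq_nonneg A]
  obtain ⟨hχ0, hχle⟩ := hχ01 (‖y‖ / (K₀ * Real.sqrt s))
  exact cutoff_product_le (by linarith) (by linarith) hB hs0 (norm_nonneg _) hJ0 hI hG hJ
    (hs₀ s ((le_max_right _ _).trans hs))
end

section
/- Let p > 3, 0 < β < 2/(p−1), 0 < ε < min(1, (p−1)/4), and K₀ ≥ 1. Define, for y ∈ ℝ and s ≥ 1, φ(y,s) = f(y/√s) + (κ/(2ps)) χ₀(y/g_ε(s)) and the rest term R(y,s) = ∂²_y φ(y,s) − (y/2) ∂_y φ(y,s) − φ(y,s)/(p−1) + φ(y,s)^p − ∂_s φ(y,s). Then there exist C > 0 and s₃ ≥ 1 such that for all s ≥ s₃ and all y ∈ ℝ with |y| ≥ K₀√s, one has (1 + |y|^β) |R(y,s)| ≤ C s^{−(1−β)/2}. -/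
open Real

/-- The one-dimensional profile `φ(y,s) = f(y/√s) + (κ/(2ps)) χ₀(y/g_ε(s))`, where
`f(z) = (p-1+bz²)^{-1/(p-1)}`, `b = (p-1)²/(4p)`, `κ = (p-1)^{-1/(p-1)}`,
`g_ε(s) = s^{1/2+ε}`. -/
noncomputable def phi1 (p ε : ℝ) (χ₀ : ℝ → ℝ) (s y : ℝ) : ℝ :=
  (p - 1 + (p - 1) ^ 2 / (4 * p) * (y / Real.sqrt s) ^ 2) ^ (-(1 / (p - 1))) +
    (p - 1) ^ (-(1 / (p - 1))) / (2 * p * s) * χ₀ (y / s ^ (1 / 2 + ε))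

/-- The rest term `R(y,s) = ∂²_yφ - (y/2)∂_yφ - φ/(p-1) + φ^p - ∂_sφ`. -/
noncomputable def restR (p ε : ℝ) (χ₀ : ℝ → ℝ) (s y : ℝ) : ℝ :=
  deriv (deriv (phi1 p ε χ₀ s)) y - y / 2 * deriv (phi1 p ε χ₀ s) y -
    phi1 p ε χ₀ s y / (p - 1) + phi1 p ε χ₀ s y ^ p - deriv (fun σ => phi1 p ε χ₀ σ y) s

/-- For a smooth function `χ` supported in `[-2, 2]`, the functions `χ`, `w * deriv χ w` and
`deriv (deriv χ)` are bounded by a common multiple of the indicator of `[-2, 2]`. -/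
lemma exists_bound_cutoff {χ : ℝ → ℝ} (hχ : ContDiff ℝ (⊤ : ℕ∞) χ)
    (hχsupp : Function.support χ ⊆ Set.Icc (-2 : ℝ) 2) :
    ∃ M > 0, ∀ w, |χ w| ≤ M * (if |w| ≤ 2 then 1 else 0) ∧
      |w * deriv χ w| ≤ M * (if |w| ≤ 2 then 1 else 0) ∧
      |deriv (deriv χ) w| ≤ M * (if |w| ≤ 2 then 1 else 0) := by
  have ts {g : ℝ → ℝ} (hg : Function.support g ⊆ Set.Icc (-2 : ℝ) 2) :
      Function.support (deriv g) ⊆ Set.Icc (-2 : ℝ) 2 :=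
    support_deriv_subset.trans (closure_minimal hg isClosed_Icc)
  have bd {g : ℝ → ℝ} (hg : Function.support g ⊆ Set.Icc (-2 : ℝ) 2) (hc : Continuous g) :
      ∃ M > 0, ∀ w, |g w| ≤ M * (if |w| ≤ 2 then 1 else 0) := by
    obtain ⟨M, hM⟩ := (isCompact_Icc (a := (-2 : ℝ)) (b := 2)).exists_bound_of_continuousOn
      hc.continuousOn
    refine ⟨|M| + 1, by positivity, fun w => ?_⟩
    split_ifs with h
    · have := hM w (abs_le.mp h)
      rw [Real.norm_eq_abs] at this
      linarith [le_abs_self M]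
    · have : g w = 0 := by
        by_contra h0
        exact h (abs_le.mpr (hg h0))
      simp [this]
  have c1 : ContDiff ℝ (⊤ : ℕ∞) (deriv χ) := (contDiff_infty_iff_deriv.mp hχ).2
  have c2 : ContDiff ℝ (⊤ : ℕ∞) (deriv (deriv χ)) := (contDiff_infty_iff_deriv.mp c1).2
  obtain ⟨M₀, h₀, H₀⟩ := bd hχsupp hχ.continuous
  obtain ⟨M₁, h₁, H₁⟩ := bd (g := fun w => w * deriv χ w)
    (fun w hw => ts hχsupp (right_ne_zero_of_mul hw)) (continuous_id.mul c1.continuous)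
  obtain ⟨M₂, h₂, H₂⟩ := bd (ts (ts hχsupp)) c2.continuous
  refine ⟨M₀ + M₁ + M₂, by positivity, fun w => ⟨(H₀ w).trans ?_, (H₁ w).trans ?_, (H₂ w).trans ?_⟩⟩
  all_goals
    gcongr
    linarith

/-- First space derivative of the profile. -/
lemma hasDerivAt_profile {a b c : ℝ} (hb : 0 ≤ b) (hc : 0 < c) (r y : ℝ) :
    HasDerivAt (fun y => (c + b * (y / r) ^ 2) ^ (-a))
      (-(2 * a * b) * (y / r) / r * (c + b * (y / r) ^ 2) ^ (-a - 1)) y := by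
  have h0 : c + b * (y / r) ^ 2 ≠ 0 := by positivity
  have h1 : HasDerivAt (fun y => c + b * (y / r) ^ 2) (2 * b * (y / r) / r) y := by
    have := ((((hasDerivAt_id y).div_const r).pow 2).const_mul b).const_add c
    refine this.congr_deriv ?_
    simp
    ring
  refine (h1.rpow_const (Or.inl h0)).congr_deriv ?_
  ring

/-- Second space derivative of the profile. -/
lemma hasDerivAt_deriv_profile {a b c : ℝ} (hb : 0 ≤ b) (hc : 0 < c) (r y : ℝ) :
    HasDerivAt (fun y => -(2 * a * b) * (y / r) / r * (c + b * (y / r) ^ 2) ^ (-a - 1))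
      ((-(2 * a * b) * (c + b * (y / r) ^ 2) ^ (-a - 1) +
        4 * a * (a + 1) * b * (b * (y / r) ^ 2) * (c + b * (y / r) ^ 2) ^ (-a - 2)) / r ^ 2) y := by
  have h1 : HasDerivAt (fun y => -(2 * a * b) * (y / r) / r) (-(2 * a * b) * (1 / r) / r) y :=
    (((hasDerivAt_id y).div_const r).const_mul _).div_const r
  have h2 := hasDerivAt_profile (a := a + 1) hb hc r y
  rw [show -(a + 1) = -a - 1 by ring, show -a - 1 - 1 = -a - 2 by ring] at h2
  refine (h1.mul h2).congr_deriv ?_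
  ring

/-- First space derivative of `phi1`. -/
lemma hasDerivAt_phi1 {p ε : ℝ} {χ : ℝ → ℝ} (hp : 1 < p) (hχ : Differentiable ℝ χ) (s y : ℝ) :
    HasDerivAt (phi1 p ε χ s)
      (-(2 * (1 / (p - 1)) * ((p - 1) ^ 2 / (4 * p))) * (y / √s) / √s *
          (p - 1 + (p - 1) ^ 2 / (4 * p) * (y / √s) ^ 2) ^ (-(1 / (p - 1)) - 1) +
        (p - 1) ^ (-(1 / (p - 1))) / (2 * p * s) *
          (deriv χ (y / s ^ (1 / 2 + ε)) / s ^ (1 / 2 + ε))) y := by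
  have hc : 0 < p - 1 := by linarith
  have h := (hχ (y / s ^ (1 / 2 + ε))).hasDerivAt.comp y
    ((hasDerivAt_id y).div_const (s ^ (1 / 2 + ε)))
  refine ((hasDerivAt_profile (by positivity) hc (√s) y).add (h.const_mul _)).congr_deriv ?_
  ring

/-- Second space derivative of `phi1`. -/
lemma hasDerivAt_deriv_phi1 {p ε : ℝ} {χ : ℝ → ℝ} (hp : 1 < p) (hχ : Differentiable ℝ χ)
    (hχ' : Differentiable ℝ (deriv χ)) (s y : ℝ) :
    HasDerivAt (deriv (phi1 p ε χ s))
      ((-(2 * (1 / (p - 1)) * ((p - 1) ^ 2 / (4 * p))) *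
            (p - 1 + (p - 1) ^ 2 / (4 * p) * (y / √s) ^ 2) ^ (-(1 / (p - 1)) - 1) +
          4 * (1 / (p - 1)) * (1 / (p - 1) + 1) * ((p - 1) ^ 2 / (4 * p)) *
            ((p - 1) ^ 2 / (4 * p) * (y / √s) ^ 2) *
            (p - 1 + (p - 1) ^ 2 / (4 * p) * (y / √s) ^ 2) ^ (-(1 / (p - 1)) - 2)) / √s ^ 2 +
        (p - 1) ^ (-(1 / (p - 1))) / (2 * p * s) *
          (deriv (deriv χ) (y / s ^ (1 / 2 + ε)) / (s ^ (1 / 2 + ε)) ^ 2)) y := by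
  have hc : 0 < p - 1 := by linarith
  rw [funext fun y => (hasDerivAt_phi1 (ε := ε) hp hχ s y).deriv]
  have h := ((hχ' (y / s ^ (1 / 2 + ε))).hasDerivAt.comp y
    ((hasDerivAt_id y).div_const (s ^ (1 / 2 + ε)))).div_const (s ^ (1 / 2 + ε))
  refine ((hasDerivAt_deriv_profile (by positivity) hc (√s) y).add
    (h.const_mul _)).congr_deriv ?_
  ring

/-- Time derivative of `phi1`. -/
lemma hasDerivAt_phi1_time {p ε : ℝ} {χ : ℝ → ℝ} (hp : 1 < p) (hχ : Differentiable ℝ χ)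
    {s : ℝ} (hs : 0 < s) (y : ℝ) :
    HasDerivAt (fun σ => phi1 p ε χ σ y)
      ((1 / (p - 1)) * ((p - 1) ^ 2 / (4 * p) * (y / √s) ^ 2) / s *
          (p - 1 + (p - 1) ^ 2 / (4 * p) * (y / √s) ^ 2) ^ (-(1 / (p - 1)) - 1) -
        (p - 1) ^ (-(1 / (p - 1))) / (2 * p * s) / s *
          (χ (y / s ^ (1 / 2 + ε)) + (1 / 2 + ε) *
            (y / s ^ (1 / 2 + ε) * deriv χ (y / s ^ (1 / 2 + ε))))) s := by
  have hc : 0 < p - 1 := by linarith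
  have hr : 0 < √s := Real.sqrt_pos.mpr hs
  have hg : 0 < s ^ (1 / 2 + ε) := Real.rpow_pos_of_pos hs _
  have e1 : HasDerivAt (fun σ => y / √σ) (-(y / √s) / (2 * s)) s := by
    refine ((hasDerivAt_const s y).div (Real.hasDerivAt_sqrt hs.ne') hr.ne').congr_deriv ?_
    have hsq := Real.sq_sqrt hs.le
    simp only [zero_mul, zero_sub]
    rw [hsq]
    field_simp
  have e2 : HasDerivAt (fun σ : ℝ => y / σ ^ (1 / 2 + ε))
      (-(1 / 2 + ε) * (y / s ^ (1 / 2 + ε)) / s) s := by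
    refine ((hasDerivAt_const s y).div
      (Real.hasDerivAt_rpow_const (Or.inl hs.ne')) hg.ne').congr_deriv ?_
    rw [Real.rpow_sub_one hs.ne']
    field_simp
    simp
  have e3 : HasDerivAt (fun σ : ℝ => (p - 1) ^ (-(1 / (p - 1))) / (2 * p * σ))
      (-((p - 1) ^ (-(1 / (p - 1))) / (2 * p * s) / s)) s := by
    refine ((hasDerivAt_const s ((p - 1) ^ (-(1 / (p - 1))))).div
      ((hasDerivAt_id s).const_mul (2 * p)) (by simp; constructor <;> linarith)).congr_deriv ?_
    simp only [id]
    field_simp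
    simp
  have h0 : p - 1 + (p - 1) ^ 2 / (4 * p) * (y / √s) ^ 2 ≠ 0 := by positivity
  have e4 := (((e1.pow 2).const_mul ((p - 1) ^ 2 / (4 * p))).const_add (p - 1)).rpow_const
    (p := -(1 / (p - 1))) (Or.inl h0)
  have e5 := (hχ (y / s ^ (1 / 2 + ε))).hasDerivAt.comp s e2
  refine (e4.add (e3.mul e5)).congr_deriv ?_
  simp only [Function.comp, Pi.pow_apply]
  push_cast
  ring

/-- The rest term in closed form: the profile cancels in the leading order. -/
lemma restR_eq {p ε : ℝ} {χ : ℝ → ℝ} (hp : 1 < p) (hχ : Differentiable ℝ χ)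
    (hχ' : Differentiable ℝ (deriv χ)) {s : ℝ} (hs : 0 < s) (y : ℝ) {a b K w A B : ℝ}
    (ha : a = 1 / (p - 1)) (hb : b = (p - 1) ^ 2 / (4 * p))
    (hK : K = (p - 1) ^ (-(1 / (p - 1))) / (2 * p)) (hw : w = y / s ^ (1 / 2 + ε))
    (hB : B = b * (y / √s) ^ 2) (hA : A = p - 1 + B) :
    restR p ε χ s y =
      (-(2 * a * b) * A ^ (-a - 1) + 4 * a * (a + 1) * b * (B * A ^ (-a - 2)) -
        a * (B * A ^ (-a - 1)) +
        K * (deriv (deriv χ) w / (s ^ (1 / 2 + ε)) ^ 2 - w * deriv χ w / 2 - a * χ w +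
          χ w / s + (1 / 2 + ε) * (w * deriv χ w) / s)) / s +
      ((A ^ (-a) + K / s * χ w) ^ p - (A ^ (-a)) ^ p) := by
  have hc : 0 < p - 1 := by linarith
  have hB0 : 0 ≤ B := by rw [hB, hb]; positivity
  have hA0 : 0 < A := by linarith
  have hr : 0 < √s := Real.sqrt_pos.mpr hs
  have hg : 0 < s ^ (1 / 2 + ε) := Real.rpow_pos_of_pos hs _
  have hap : a * (p - 1) = 1 := by rw [ha]; field_simp
  have hpow : (A ^ (-a)) ^ p = A ^ (-a - 1) := by
    rw [← Real.rpow_mul hA0.le]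
    congr 1
    linarith
  have hlow : A ^ (-a) = A * A ^ (-a - 1) := by
    rw [Real.rpow_sub_one hA0.ne']
    field_simp
  have hphi : phi1 p ε χ s y = A ^ (-a) + K / s * χ w := by
    rw [phi1, hA, hB, ha, hb, hK, hw]
    ring
  have hK' : (p - 1) ^ (-(1 / (p - 1))) / (2 * p * s) = K / s := by
    rw [hK]; field_simp
  rw [restR, (hasDerivAt_deriv_phi1 hp hχ hχ' s y).deriv, (hasDerivAt_phi1 hp hχ s y).deriv,
    (hasDerivAt_phi1_time hp hχ hs y).deriv, hphi, hK', ← ha, ← hb, ← hw, ← hB, ← hA, hpow,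
    Real.sq_sqrt hs.le]
  have hy1 : y / 2 * (-(2 * a * b) * (y / √s) / √s * A ^ (-a - 1) +
      K / s * (deriv χ w / s ^ (1 / 2 + ε))) =
      -a * B * A ^ (-a - 1) + K / s * (w * deriv χ w) / 2 := by
    rw [hB, hw]; ring
  have hdiv : (A ^ (-a) + K / s * χ w) / (p - 1) = a * (A * A ^ (-a - 1)) + a * (K / s * χ w) := by
    rw [← hlow, ha]; ring
  rw [hy1, hdiv]
  linear_combination (-a * A ^ (-a - 1)) * hA + (-A ^ (-a - 1)) * hap

/-- `x ↦ x ^ p` is Lipschitz on `[0, M]`. -/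
lemma abs_rpow_sub_rpow_le_s15 {p M x y : ℝ} (hp : 1 ≤ p) (hx : x ∈ Set.Icc 0 M)
    (hy : y ∈ Set.Icc 0 M) : |y ^ p - x ^ p| ≤ p * M ^ (p - 1) * |y - x| := by
  refine (convex_Icc 0 M).norm_image_sub_le_of_norm_hasDerivWithin_le
    (f := fun t : ℝ => t ^ p) (f' := fun t => p * t ^ (p - 1))
    (fun t _ => (Real.hasDerivAt_rpow_const (Or.inr hp)).hasDerivWithinAt) (fun t ht => ?_) hx hy
  have := ht.1
  rw [Real.norm_eq_abs, abs_of_nonneg (by positivity)]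
  exact mul_le_mul_of_nonneg_left (Real.rpow_le_rpow ht.1 ht.2 (by linarith)) (by linarith)

/-- The rest term is `O(1/s)` times the profile plus the indicator of the cut-off region. -/
lemma abs_restR_le {p ε : ℝ} {χ : ℝ → ℝ} (hp : 2 ≤ p) (hε0 : 0 < ε) (hε1 : ε ≤ 1)
    (hχ : ContDiff ℝ (⊤ : ℕ∞) χ) (hχ0 : ∀ w, 0 ≤ χ w)
    (hχsupp : Function.support χ ⊆ Set.Icc (-2 : ℝ) 2) :
    ∃ C > 0, ∀ s ≥ 1, ∀ y, |restR p ε χ s y| ≤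
      C * ((p - 1 + (p - 1) ^ 2 / (4 * p) * (y / √s) ^ 2) ^ (-(1 / (p - 1))) +
        (if |y / s ^ (1 / 2 + ε)| ≤ 2 then 1 else 0)) / s := by
  obtain ⟨M, hM, hbd⟩ := exists_bound_cutoff hχ hχsupp
  have d0 : Differentiable ℝ χ := hχ.differentiable (by simp)
  have c1 : ContDiff ℝ (⊤ : ℕ∞) (deriv χ) := (contDiff_infty_iff_deriv.mp hχ).2
  have d1 : Differentiable ℝ (deriv χ) := c1.differentiable (by simp)
  have hc : 0 < p - 1 := by linarith
  obtain ⟨a, ha⟩ : ∃ a, a = 1 / (p - 1) := ⟨_, rfl⟩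
  obtain ⟨b, hb⟩ : ∃ b, b = (p - 1) ^ 2 / (4 * p) := ⟨_, rfl⟩
  obtain ⟨K, hK⟩ : ∃ K, K = (p - 1) ^ (-(1 / (p - 1))) / (2 * p) := ⟨_, rfl⟩
  have ha0 : 0 < a := by rw [ha]; positivity
  have hb0 : 0 < b := by rw [hb]; positivity
  have hK0 : 0 < K := by rw [hK]; positivity
  refine ⟨(2 * a * b + 4 * a * (a + 1) * b + a) + K * ((5 + a) * M) +
    p * (1 + K * M) ^ (p - 1) * (K * M), by positivity, fun s hs y => ?_⟩
  have hs0 : 0 < s := by linarith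
  obtain ⟨w, hw⟩ : ∃ w, w = y / s ^ (1 / 2 + ε) := ⟨_, rfl⟩
  obtain ⟨B, hB⟩ : ∃ B, B = b * (y / √s) ^ 2 := ⟨_, rfl⟩
  obtain ⟨A, hA⟩ : ∃ A, A = p - 1 + B := ⟨_, rfl⟩
  rw [restR_eq (by linarith) d0 d1 hs0 y ha hb hK hw hB hA, ← ha, ← hb, ← hw, ← hB, ← hA]
  obtain ⟨h0, h1, h2⟩ := hbd w
  obtain ⟨J, hJ⟩ : ∃ J : ℝ, J = if |w| ≤ 2 then 1 else 0 := ⟨_, rfl⟩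
  rw [← hJ] at h0 h1 h2 ⊢
  have hJ0 : 0 ≤ J := by rw [hJ]; split_ifs <;> norm_num
  have hJ1 : J ≤ 1 := by rw [hJ]; split_ifs <;> norm_num
  have hB0 : 0 ≤ B := by rw [hB]; positivity
  have hA1 : 1 ≤ A := by linarith
  have hBA : B ≤ A := by linarith
  have hA0 : 0 < A := by linarith
  have hg : 1 ≤ s ^ (1 / 2 + ε) := Real.one_le_rpow hs (by linarith)
  obtain ⟨F, hF⟩ : ∃ F, F = A ^ (-a) := ⟨_, rfl⟩
  have hF0 : 0 < F := by rw [hF]; positivity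
  have hF1 : F ≤ 1 := by rw [hF]; exact Real.rpow_le_one_of_one_le_of_nonpos hA1 (by linarith)
  have p1 : A ^ (-a - 1) ≤ F := by
    rw [hF]; exact Real.rpow_le_rpow_of_exponent_le hA1 (by linarith)
  have p2 : B * A ^ (-a - 1) ≤ F := by
    rw [Real.rpow_sub_one hA0.ne', ← hF, mul_div_assoc', div_le_iff₀ hA0, mul_comm]
    gcongr
  have p3 : B * A ^ (-a - 2) ≤ F :=
    (mul_le_mul_of_nonneg_left
      (Real.rpow_le_rpow_of_exponent_le hA1 (by linarith)) hB0).trans p2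
  have main : |-(2 * a * b) * A ^ (-a - 1) + 4 * a * (a + 1) * b * (B * A ^ (-a - 2)) -
      a * (B * A ^ (-a - 1))| ≤ (2 * a * b + 4 * a * (a + 1) * b + a) * F := by
    have r1 := mul_le_mul_of_nonneg_left p1 (by positivity : 0 ≤ 2 * a * b)
    have r2 := mul_le_mul_of_nonneg_left p2 ha0.le
    have r3 := mul_le_mul_of_nonneg_left p3 (by positivity : 0 ≤ 4 * a * (a + 1) * b)
    have t1 : 0 ≤ 2 * a * b * A ^ (-a - 1) := by positivity
    have t2 : 0 ≤ a * (B * A ^ (-a - 1)) := by positivity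
    have t3 : 0 ≤ 4 * a * (a + 1) * b * (B * A ^ (-a - 2)) := by positivity
    rw [abs_le]
    constructor <;> linarith
  have cut : |K * (deriv (deriv χ) w / (s ^ (1 / 2 + ε)) ^ 2 - w * deriv χ w / 2 - a * χ w +
      χ w / s + (1 / 2 + ε) * (w * deriv χ w) / s)| ≤ K * ((5 + a) * M) * J := by
    rw [abs_mul, abs_of_pos hK0, mul_assoc]
    gcongr
    have hMJ : 0 ≤ M * J := by positivity
    have shrink {x t : ℝ} (hx : |x| ≤ M * J) (ht : 1 ≤ t) : |x / t| ≤ M * J := by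
      rw [abs_div, abs_of_pos (by linarith : 0 < t)]
      exact (div_le_self (abs_nonneg x) ht).trans hx
    have u1 := abs_le.mp (shrink h2 (one_le_pow₀ (n := 2) hg))
    have u2 := abs_le.mp (shrink h1 (one_le_two))
    have u3 := abs_le.mp (shrink h0 hs)
    have u4 : |(1 / 2 + ε) * (w * deriv χ w) / s| ≤ 2 * (M * J) := by
      rw [mul_div_assoc, abs_mul, abs_of_pos (by linarith : 0 < 1 / 2 + ε)]
      exact mul_le_mul (by linarith) (shrink h1 hs) (abs_nonneg _) (by norm_num)
    have u5 : |a * χ w| ≤ a * (M * J) := by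
      rw [abs_mul, abs_of_pos ha0]
      gcongr
    have u4 := abs_le.mp u4
    have u5 := abs_le.mp u5
    rw [abs_le]
    constructor <;> linarith
  have hχM : χ w ≤ M * J := (le_abs_self _).trans h0
  have hKs : K / s * χ w ≤ K * M * J / s := by
    rw [div_mul_eq_mul_div, mul_assoc]
    gcongr
  have hKs1 : K / s * χ w ≤ K * M := by
    refine hKs.trans ((div_le_self (by positivity) hs).trans ?_)
    exact mul_le_of_le_one_right (by positivity) hJ1
  have hKs0 : 0 ≤ K / s * χ w := mul_nonneg (by positivity) (hχ0 w)
  have pow : |(F + K / s * χ w) ^ p - F ^ p| ≤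
      p * (1 + K * M) ^ (p - 1) * (K * M * J / s) := by
    refine (abs_rpow_sub_rpow_le_s15 (M := 1 + K * M) (by linarith)
      ⟨hF0.le, by linarith⟩ ⟨by linarith, by linarith⟩).trans ?_
    rw [add_sub_cancel_left, abs_of_nonneg hKs0]
    gcongr
  rw [← hF]
  refine (abs_add_le _ _).trans ((add_le_add
    (b := ((2 * a * b + 4 * a * (a + 1) * b + a) * F + K * ((5 + a) * M) * J) / s)
    ?_ pow).trans ?_)
  · rw [abs_div, abs_of_pos hs0]
    gcongr
    exact (abs_add_le _ _).trans (add_le_add main cut)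
  · rw [mul_div_assoc', ← add_div]
    gcongr
    have v1 : 0 ≤ (2 * a * b + 4 * a * (a + 1) * b + a) * J := by positivity
    have v2 : 0 ≤ K * ((5 + a) * M) * F := by positivity
    have v3 : 0 ≤ p * (1 + K * M) ^ (p - 1) * (K * M) * F := by positivity
    linarith

theorem stmt_15 (p β ε K₀ : ℝ) (hp : 3 < p) (hβ0 : 0 < β) (hβ1 : β < 2 / (p - 1))
    (hε0 : 0 < ε) (hε1 : ε < min 1 ((p - 1) / 4)) (hK₀ : 1 ≤ K₀)
    (χ₀ : ℝ → ℝ) (hχ : ContDiff ℝ (⊤ : ℕ∞) χ₀) (hχ01 : ∀ z, 0 ≤ χ₀ z ∧ χ₀ z ≤ 1)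
    (hχ1 : ∀ z ∈ Set.Icc (-1 : ℝ) 1, χ₀ z = 1)
    (hχsupp : Function.support χ₀ ⊆ Set.Icc (-2 : ℝ) 2) :
    ∃ C > (0 : ℝ), ∃ s₃ ≥ (1 : ℝ), ∀ s ≥ s₃, ∀ y : ℝ, K₀ * Real.sqrt s ≤ |y| →
      (1 + |y| ^ β) * |restR p ε χ₀ s y| ≤ C * s ^ (-((1 - β) / 2)) := by
  have hc : 0 < p - 1 := by linarith
  obtain ⟨C, hC, hR⟩ := abs_restR_le (by linarith : 2 ≤ p) hε0 (hε1.trans_le (min_le_left _ _)).le hχ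
    (fun w => (hχ01 w).1) hχsupp
  obtain ⟨a, ha⟩ : ∃ a, a = 1 / (p - 1) := ⟨_, rfl⟩
  obtain ⟨b, hb⟩ : ∃ b, b = (p - 1) ^ 2 / (4 * p) := ⟨_, rfl⟩
  rw [← ha, ← hb] at hR
  have ha0 : 0 < a := by rw [ha]; positivity
  have hb0 : 0 < b := by rw [hb]; positivity
  have hβa : β ≤ 2 * a := by rw [ha, mul_one_div]; exact hβ1.le
  have hεβ : ε * β ≤ 1 / 2 := by
    have h1 : ε ≤ (p - 1) / 4 := (hε1.trans_le (min_le_right _ _)).le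
    calc ε * β ≤ (p - 1) / 4 * (2 / (p - 1)) := by gcongr
      _ = 1 / 2 := by field_simp; norm_num
  refine ⟨2 * C * (b ^ (-a) + 2 ^ β), by positivity, 1, le_rfl, fun s hs y hy => ?_⟩
  have hs0 : 0 < s := by linarith
  have hr1 : 1 ≤ √s := Real.one_le_sqrt.mpr hs
  have hry : √s ≤ |y| := (le_mul_of_one_le_left (by linarith) hK₀).trans hy
  have hz1 : 1 ≤ |y| / √s := (one_le_div (by linarith)).mpr hry
  have hyβ : 1 ≤ |y| ^ β := Real.one_le_rpow (hr1.trans hry) hβ0.le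
  have hsβ : √s ^ β = s ^ (β / 2) := by
    rw [Real.sqrt_eq_rpow, ← Real.rpow_mul hs0.le]
    congr 1
    ring
  have outer : |y| ^ β * (p - 1 + b * (y / √s) ^ 2) ^ (-a) ≤ b ^ (-a) * s ^ (β / 2 + 1 / 2) := by
    have hsq : (y / √s) ^ 2 = (|y| / √s) ^ (2 : ℝ) := by
      rw [Real.rpow_two, div_pow, div_pow, sq_abs]
    calc |y| ^ β * (p - 1 + b * (y / √s) ^ 2) ^ (-a)
        ≤ |y| ^ β * (b * (y / √s) ^ 2) ^ (-a) := by
          gcongr ?_ * ?_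
          refine Real.rpow_le_rpow_of_nonpos ?_ (by linarith) (by linarith)
          rw [hsq]
          positivity
      _ = |y| ^ β * (b ^ (-a) * (|y| / √s) ^ (-(2 * a))) := by
          rw [Real.mul_rpow hb0.le (sq_nonneg _), hsq, ← Real.rpow_mul (by positivity)]
          ring_nf
      _ ≤ |y| ^ β * (b ^ (-a) * (|y| / √s) ^ (-β)) := by
          gcongr
      _ = b ^ (-a) * s ^ (β / 2) := by
          have : 0 < |y| := by linarith
          rw [Real.rpow_neg (y := β) (by positivity), Real.div_rpow (by positivity) (by positivity), hsβ]
          field_simp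
      _ ≤ b ^ (-a) * s ^ (β / 2 + 1 / 2) := by
          gcongr
          linarith
  have inner : |y| ^ β * (if |y / s ^ (1 / 2 + ε)| ≤ 2 then 1 else 0) ≤
      2 ^ β * s ^ (β / 2 + 1 / 2) := by
    split_ifs with h
    · have hg : 0 < s ^ (1 / 2 + ε) := by positivity
      rw [abs_div, abs_of_pos hg, div_le_iff₀ hg] at h
      calc |y| ^ β * 1 ≤ (2 * s ^ (1 / 2 + ε)) ^ β := by
            rw [mul_one]
            gcongr
        _ = 2 ^ β * s ^ ((1 / 2 + ε) * β) := by
            rw [Real.mul_rpow (by norm_num) hg.le, ← Real.rpow_mul hs0.le]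
        _ ≤ 2 ^ β * s ^ (β / 2 + 1 / 2) := by
            gcongr
            linarith
    · rw [mul_zero]
      positivity
  have hexp : s ^ (β / 2 + 1 / 2) / s = s ^ (-((1 - β) / 2)) := by
    rw [← Real.rpow_sub_one hs0.ne']
    congr 1
    ring
  calc (1 + |y| ^ β) * |restR p ε χ₀ s y|
      ≤ (2 * |y| ^ β) * (C * ((p - 1 + b * (y / √s) ^ 2) ^ (-a) +
        (if |y / s ^ (1 / 2 + ε)| ≤ 2 then 1 else 0)) / s) := by
        gcongr
        · linarith
        · exact hR s hs y
    _ = 2 * C * (|y| ^ β * (p - 1 + b * (y / √s) ^ 2) ^ (-a) +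
        |y| ^ β * (if |y / s ^ (1 / 2 + ε)| ≤ 2 then 1 else 0)) / s := by ring
    _ ≤ 2 * C * (b ^ (-a) * s ^ (β / 2 + 1 / 2) + 2 ^ β * s ^ (β / 2 + 1 / 2)) / s := by
        gcongr
    _ = 2 * C * (b ^ (-a) + 2 ^ β) * (s ^ (β / 2 + 1 / 2) / s) := by ring
    _ = 2 * C * (b ^ (-a) + 2 ^ β) * s ^ (-((1 - β) / 2)) := by rw [hexp]
end

section
/- Let N ≥ 1, p > 3, 0 < ε < min(1, (p−1)/4), and define the potential V(y,s) = p φ(y,s)^{p−1} − p/(p−1) for y ∈ ℝ^N, s ≥ 1. Then: (a) ∫_{ℝ^N} V(y,s)² ρ(y) dy → 0 as s → ∞, where ρ(y) = e^{−|y|²/4}/(4π)^{N/2}; and (b) for every δ > 0 there exist C_δ > 0 and s_δ ≥ 1 such that for all s ≥ s_δ and all y ∈ ℝ^N with |y| ≥ C_δ √s, one has |V(y,s) + p/(p−1)| ≤ δ. -/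
open MeasureTheory Real Filter

/-- The potential `V(y,s) = pφ(y,s)^{p-1} - p/(p-1)`. -/
noncomputable def potV (N : ℕ) (p ε : ℝ) (χ₀ : EuclideanSpace ℝ (Fin N) → ℝ)
    (s : ℝ) (y : EuclideanSpace ℝ (Fin N)) : ℝ :=
  p * profPhi N p ε χ₀ s y ^ (p - 1) - p / (p - 1)

/-- The cut-off correction in `profPhi` lies between `0` and its amplitude. -/
theorem profPhi_bounds (N : ℕ) {p ε : ℝ} (hp : 1 < p) {χ₀ : EuclideanSpace ℝ (Fin N) → ℝ}
    (hχ01 : ∀ z, 0 ≤ χ₀ z ∧ χ₀ z ≤ 1) {s : ℝ} (hs : 0 < s) (y : EuclideanSpace ℝ (Fin N)) :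
    (p - 1 + (p - 1) ^ 2 / (4 * p) * ‖(Real.sqrt s)⁻¹ • y‖ ^ 2) ^ (-(1 / (p - 1)))
        ≤ profPhi N p ε χ₀ s y ∧
      profPhi N p ε χ₀ s y ≤
        (p - 1 + (p - 1) ^ 2 / (4 * p) * ‖(Real.sqrt s)⁻¹ • y‖ ^ 2) ^ (-(1 / (p - 1))) +
          (p - 1) ^ (-(1 / (p - 1))) * N / (2 * p) / s := by
  have hp1 : 0 < p - 1 := by linarith
  have hp0 : 0 < p := by linarith
  have hA : 0 ≤ (p - 1) ^ (-(1 / (p - 1))) * N / (2 * p * s) := by positivity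
  have hχ := hχ01 ((s ^ (1 / 2 + ε))⁻¹ • y)
  unfold profPhi
  rw [div_div]
  exact ⟨le_add_of_nonneg_right (mul_nonneg hA hχ.1),
    add_le_add le_rfl (mul_le_of_le_one_right hA hχ.2)⟩

theorem base_pos {p : ℝ} (hp : 1 < p) (r : ℝ) :
    0 < p - 1 + (p - 1) ^ 2 / (4 * p) * r ^ 2 := by
  have hp1 : 0 < p - 1 := by linarith
  have hp0 : 0 < p := by linarith
  positivity

theorem profPhi_nonneg (N : ℕ) {p ε : ℝ} (hp : 1 < p) {χ₀ : EuclideanSpace ℝ (Fin N) → ℝ}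
    (hχ01 : ∀ z, 0 ≤ χ₀ z ∧ χ₀ z ≤ 1) {s : ℝ} (hs : 0 < s) (y : EuclideanSpace ℝ (Fin N)) :
    0 ≤ profPhi N p ε χ₀ s y :=
  (Real.rpow_nonneg (base_pos hp _).le _).trans (profPhi_bounds N hp hχ01 hs y).1

theorem continuous_potV (N : ℕ) {p : ℝ} (ε : ℝ) (hp : 1 < p)
    {χ₀ : EuclideanSpace ℝ (Fin N) → ℝ} (hχ : Continuous χ₀) (s : ℝ) :
    Continuous (potV N p ε χ₀ s) := by
  unfold potV
  refine (continuous_const.mul (Continuous.rpow_const ?_ fun _ => Or.inr (by linarith))).sub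
    continuous_const
  unfold profPhi
  refine (Continuous.rpow_const (by fun_prop) fun y => Or.inl (base_pos hp _).ne').add ?_
  fun_prop

/-- A bound for the potential that is uniform in `y` and `s ≥ 1`. -/
theorem abs_potV_le (N : ℕ) {p ε : ℝ} (hp : 1 < p) {χ₀ : EuclideanSpace ℝ (Fin N) → ℝ}
    (hχ01 : ∀ z, 0 ≤ χ₀ z ∧ χ₀ z ≤ 1) {s : ℝ} (hs : 1 ≤ s) (y : EuclideanSpace ℝ (Fin N)) :
    |potV N p ε χ₀ s y| ≤
      p * ((p - 1) ^ (-(1 / (p - 1))) + (p - 1) ^ (-(1 / (p - 1))) * N / (2 * p)) ^ (p - 1) +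
        p / (p - 1) := by
  have hp1 : 0 < p - 1 := by linarith
  have hp0 : 0 < p := by linarith
  have hs0 : 0 < s := by linarith
  have h0 := profPhi_nonneg N (ε := ε) hp hχ01 hs0 y
  have h1 : profPhi N p ε χ₀ s y ≤
      (p - 1) ^ (-(1 / (p - 1))) + (p - 1) ^ (-(1 / (p - 1))) * N / (2 * p) := by
    refine (profPhi_bounds N hp hχ01 hs0 y).2.trans (add_le_add ?_ ?_)
    · refine Real.rpow_le_rpow_of_nonpos hp1 (le_add_of_nonneg_right (by positivity)) ?_
      exact neg_nonpos.2 (by positivity)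
    · exact div_le_self (by positivity) hs
  have h2 := mul_le_mul_of_nonneg_left (Real.rpow_le_rpow h0 h1 hp1.le) hp0.le
  have h3 : 0 ≤ p * profPhi N p ε χ₀ s y ^ (p - 1) := by positivity
  have h4 : 0 ≤ p / (p - 1) := by positivity
  unfold potV
  rw [abs_le]
  constructor <;> linarith

theorem tendsto_profPhi (N : ℕ) {p : ℝ} (ε : ℝ) (hp : 1 < p)
    {χ₀ : EuclideanSpace ℝ (Fin N) → ℝ} (hχ01 : ∀ z, 0 ≤ χ₀ z ∧ χ₀ z ≤ 1)
    (y : EuclideanSpace ℝ (Fin N)) :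
    Tendsto (fun s => profPhi N p ε χ₀ s y) atTop (nhds ((p - 1) ^ (-(1 / (p - 1))))) := by
  have hp1 : 0 < p - 1 := by linarith
  have h1 : Tendsto (fun s : ℝ => ‖(Real.sqrt s)⁻¹ • y‖) atTop (nhds 0) := by
    simpa using ((Real.tendsto_sqrt_atTop.inv_tendsto_atTop).smul_const y).norm
  have h2 : Tendsto (fun s : ℝ => (p - 1 + (p - 1) ^ 2 / (4 * p) *
      ‖(Real.sqrt s)⁻¹ • y‖ ^ 2) ^ (-(1 / (p - 1)))) atTop
      (nhds ((p - 1) ^ (-(1 / (p - 1))))) := by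
    refine Tendsto.rpow_const ?_ (Or.inl hp1.ne')
    simpa using tendsto_const_nhds.add (tendsto_const_nhds.mul (h1.pow 2))
  have h3 := h2.add (tendsto_const_nhds (x := (p - 1) ^ (-(1 / (p - 1))) * N / (2 * p))
    |>.div_atTop tendsto_id)
  rw [add_zero] at h3
  refine tendsto_of_tendsto_of_tendsto_of_le_of_le' h2 h3 ?_ ?_ <;>
    filter_upwards [eventually_gt_atTop 0] with s hs
  · exact (profPhi_bounds N hp hχ01 hs y).1
  · exact (profPhi_bounds N hp hχ01 hs y).2

theorem tendsto_potV (N : ℕ) {p : ℝ} (ε : ℝ) (hp : 1 < p)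
    {χ₀ : EuclideanSpace ℝ (Fin N) → ℝ} (hχ01 : ∀ z, 0 ≤ χ₀ z ∧ χ₀ z ≤ 1)
    (y : EuclideanSpace ℝ (Fin N)) :
    Tendsto (fun s => potV N p ε χ₀ s y) atTop (nhds 0) := by
  have hp1 : 0 < p - 1 := by linarith
  have h := (((tendsto_profPhi N ε hp hχ01 y).rpow_const (p := p - 1)
    (Or.inr hp1.le)).const_mul p).sub_const (p / (p - 1))
  have hκ : ((p - 1) ^ (-(1 / (p - 1)))) ^ (p - 1) = (p - 1)⁻¹ := by
    rw [← Real.rpow_mul hp1.le, neg_mul, one_div_mul_cancel hp1.ne', Real.rpow_neg_one]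
  rw [hκ, ← div_eq_mul_inv, sub_self] at h
  exact h

theorem integrable_exp_neg_norm_sq_div_four (N : ℕ) :
    Integrable fun y : EuclideanSpace ℝ (Fin N) => Real.exp (-‖y‖ ^ 2 / 4) := by
  have h := (GaussianFourier.integrable_cexp_neg_mul_sq_norm_add (V := EuclideanSpace ℝ (Fin N))
    (b := 1 / 4) (by norm_num) 0 0).norm
  refine h.congr (Eventually.of_forall fun y => ?_)
  simp only [Complex.norm_exp]
  congr 1
  simp [← Complex.ofReal_pow]
  ring

theorem tendsto_base_rpow {p : ℝ} (hp : 1 < p) :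
    Tendsto (fun r : ℝ => (p - 1 + (p - 1) ^ 2 / (4 * p) * r ^ 2) ^ (-(1 / (p - 1))))
      atTop (nhds 0) := by
  have hp1 : 0 < p - 1 := by linarith
  have hp0 : 0 < p := by linarith
  refine (tendsto_rpow_neg_atTop (y := 1 / (p - 1)) (by positivity)).comp ?_
  refine tendsto_atTop_add_const_left _ _ ?_
  exact (tendsto_pow_atTop two_ne_zero).const_mul_atTop (by positivity)

theorem stmt_16 (N : ℕ) (hN : 1 ≤ N) (p ε : ℝ) (hp : 3 < p)
    (hε0 : 0 < ε) (hε1 : ε < min 1 ((p - 1) / 4))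
    (χ₀ : EuclideanSpace ℝ (Fin N) → ℝ) (hχ : ContDiff ℝ (⊤ : ℕ∞) χ₀)
    (hχ01 : ∀ z, 0 ≤ χ₀ z ∧ χ₀ z ≤ 1)
    (hχ1 : ∀ z, ‖z‖ ≤ 1 → χ₀ z = 1)
    (hχsupp : ∀ z, 2 ≤ ‖z‖ → χ₀ z = 0) :
    -- (a) V(·,s) → 0 in L²_ρ as s → ∞
    Tendsto (fun s => ∫ y : EuclideanSpace ℝ (Fin N),
        potV N p ε χ₀ s y ^ 2 * (Real.exp (-‖y‖ ^ 2 / 4) / (4 * Real.pi) ^ ((N : ℝ) / 2)))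
      atTop (nhds 0) ∧
    -- (b) outside the blow-up region, V is close to -p/(p-1)
    (∀ δ > (0 : ℝ), ∃ C > (0 : ℝ), ∃ s₀ ≥ (1 : ℝ), ∀ s ≥ s₀,
      ∀ y : EuclideanSpace ℝ (Fin N), C * Real.sqrt s ≤ ‖y‖ →
        |potV N p ε χ₀ s y + p / (p - 1)| ≤ δ) := by
  have hp1 : 1 < p := by linarith
  constructor
  · set M := p * ((p - 1) ^ (-(1 / (p - 1))) +
      (p - 1) ^ (-(1 / (p - 1))) * N / (2 * p)) ^ (p - 1) + p / (p - 1)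
    have key := tendsto_integral_filter_of_dominated_convergence (μ := volume)
      (l := (atTop : Filter ℝ))
      (F := fun s (y : EuclideanSpace ℝ (Fin N)) => potV N p ε χ₀ s y ^ 2 *
        (Real.exp (-‖y‖ ^ 2 / 4) / (4 * Real.pi) ^ ((N : ℝ) / 2))) (f := fun _ => 0)
      (fun y => M ^ 2 * (Real.exp (-‖y‖ ^ 2 / 4) / (4 * Real.pi) ^ ((N : ℝ) / 2)))
      ?_ ?_ ?_ ?_
    · simpa using key
    · refine Eventually.of_forall fun s => Continuous.aestronglyMeasurable ?_
      have := continuous_potV N ε hp1 hχ.continuous s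
      fun_prop
    · filter_upwards [eventually_ge_atTop 1] with s hs
      refine Eventually.of_forall fun y => ?_
      have hw : 0 ≤ Real.exp (-‖y‖ ^ 2 / 4) / (4 * Real.pi) ^ ((N : ℝ) / 2) := by positivity
      rw [Real.norm_of_nonneg (mul_nonneg (sq_nonneg _) hw), ← sq_abs]
      gcongr
      exact abs_potV_le N hp1 hχ01 hs y
    · exact ((integrable_exp_neg_norm_sq_div_four N).div_const _).const_mul _
    · refine Eventually.of_forall fun y => ?_
      simpa using ((tendsto_potV N ε hp1 hχ01 y).pow 2).mul_const
        (Real.exp (-‖y‖ ^ 2 / 4) / (4 * Real.pi) ^ ((N : ℝ) / 2))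
  · intro δ hδ
    have hq : 0 < p - 1 := by linarith
    have hp0 : 0 < p := by linarith
    set η := (δ / p) ^ (1 / (p - 1)) with hη
    have hηpos : 0 < η := by positivity
    obtain ⟨C, hC, hC0⟩ := (((tendsto_base_rpow hp1).eventually_le_const
      (half_pos hηpos)).and (eventually_gt_atTop 0)).exists_forall_of_atTop.imp
        fun a h => (⟨fun r hr => (h r hr).1, (h a le_rfl).2⟩ : _ ∧ _)
    obtain ⟨s₀, hs₀, hs₀1⟩ := ((((tendsto_const_nhds
      (x := (p - 1) ^ (-(1 / (p - 1))) * N / (2 * p))).div_atTop tendsto_id).eventually_le_const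
      (half_pos hηpos)).and (eventually_ge_atTop 1)).exists_forall_of_atTop.imp
        fun a h => (⟨fun r hr => (h r hr).1, (h a le_rfl).2⟩ : _ ∧ _)
    refine ⟨C, hC0, s₀, hs₀1, fun s hs y hy => ?_⟩
    have hs0 : 0 < s := by linarith
    have hr : C ≤ ‖(Real.sqrt s)⁻¹ • y‖ := by
      rw [norm_smul, Real.norm_of_nonneg (by positivity), inv_mul_eq_div,
        le_div_iff₀ (Real.sqrt_pos.2 hs0)]
      exact hy
    have h0 := profPhi_nonneg N (ε := ε) hp1 hχ01 hs0 y
    have hle : profPhi N p ε χ₀ s y ≤ η := by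
      have h1 := (profPhi_bounds N (ε := ε) hp1 hχ01 hs0 y).2
      have h2 := hC _ hr
      have h3 := hs₀ s hs
      simp only [id] at h3
      linarith
    have hpow : profPhi N p ε χ₀ s y ^ (p - 1) ≤ δ / p := by
      refine (Real.rpow_le_rpow h0 hle hq.le).trans_eq ?_
      rw [hη, ← Real.rpow_mul (by positivity), one_div_mul_cancel hq.ne', Real.rpow_one]
    rw [potV, sub_add_cancel, abs_of_nonneg (by positivity), mul_comm]
    exact (le_div_iff₀ hp0).1 hpow
end
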